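/- Let A = Q[q, q^{−1}], let U_q^-(gl_∞)_A be the A-subalgebra of U_q^-(gl_∞) generated by the divided powers f_i^{(n)} = f_i^n/[n]! (i ∈ I, n ≥ 0), and set V_θ(0)_A = U_q^-(gl_∞)_A·φ̃ ⊆ Ṽ_θ(0). Then V_θ(0)_A = ⊕_{m∈M_θ} A·P_θ(m)φ̃. -/

import Mathlib

/-! Basic setup: `K = ℚ(q)` and the algebra `U_q^-(gl_∞)`. -/

noncomputable section

/-- The base field `K = ℚ(q)`. -/
abbrev K : Type := RatFunc ℚ

/-- The indeterminate `q`. -/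
def q : K := RatFunc.X

/-- The `q`-integer `[n]`. -/
def qint (n : ℤ) : K := (q ^ n - q ^ (-n)) / (q - q⁻¹)

/-- The `q`-factorial `[n]!`. -/
def qfact (n : ℕ) : K := ∏ k ∈ Finset.range n, qint (k + 1)

/-- The `q`-Serre relations defining `U_q^-(gl_∞)`; the generator indexed by `a : ℤ`
corresponds to `f_i` for the odd integer `i = 2a+1`, so that `|i - j| > 2 ↔ 1 < |a - b|`
and `|i - j| = 2 ↔ |a - b| = 1`. -/
inductive URel : FreeAlgebra K ℤ → FreeAlgebra K ℤ → Prop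
  | far (a b : ℤ) (h : 1 < |a - b|) :
      URel (FreeAlgebra.ι K a * FreeAlgebra.ι K b) (FreeAlgebra.ι K b * FreeAlgebra.ι K a)
  | serre (a b : ℤ) (h : |a - b| = 1) :
      URel (FreeAlgebra.ι K a * FreeAlgebra.ι K a * FreeAlgebra.ι K b
            + FreeAlgebra.ι K b * (FreeAlgebra.ι K a * FreeAlgebra.ι K a))
           ((q + q⁻¹) • (FreeAlgebra.ι K a * FreeAlgebra.ι K b * FreeAlgebra.ι K a))

/-- The algebra `U_q^-(gl_∞)`. -/
abbrev U : Type := RingQuot URel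

/-- The generator `f_i` of `U_q^-(gl_∞)`, for an odd integer `i`. -/
def fgen (i : ℤ) : U := RingQuot.mkAlgHom K URel (FreeAlgebra.ι K ((i - 1) / 2))

/-- `segAux i n` is the segment `⟨i, i+2n⟩`. -/
def segAux (i : ℤ) : ℕ → U
  | 0 => fgen i
  | n + 1 => segAux i n * fgen (i + 2 * (n + 1)) - q • (fgen (i + 2 * (n + 1)) * segAux i n)

/-- The segment `⟨i,j⟩ ∈ U_q^-(gl_∞)` for odd `i ≤ j`. -/
def seg (i j : ℤ) : U := segAux i ((j - i) / 2).toNat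

/-- The divided power `⟨i,j⟩^{(n)}` (zero for `n < 0`). -/
def segPow (i j : ℤ) (n : ℤ) : U :=
  if n < 0 then 0 else (qfact n.toNat)⁻¹ • seg i j ^ n.toNat

/-- The modified divided power `⟨i,j⟩^{[n]}`. -/
def segPowM (i j : ℤ) (n : ℤ) : U :=
  if i = -j then
    (if n < 0 then 0 else (∏ ν ∈ Finset.range n.toNat, qint (2 * (ν + 1)))⁻¹ • seg i j ^ n.toNat)
  else segPow i j n


open scoped Classical

/-- Multisegments as elements of the free abelian group on the segments `⟨i,j⟩`. -/
abbrev MS : Type := (ℤ × ℤ) →₀ ℤ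

/-- The segment `⟨i,j⟩` viewed as a multisegment. -/
def sg (i j : ℤ) : MS := Finsupp.single (i, j) 1

/-- `m` is a multisegment: supported on pairs of odd integers `i ≤ j`,
with nonnegative multiplicities. -/
def IsMulti (m : MS) : Prop :=
  ∀ i j : ℤ, m (i, j) ≠ 0 → Odd i ∧ Odd j ∧ i ≤ j ∧ 0 < m (i, j)

/-- `m` is a θ-restricted multisegment (`m_{i,j} = 0` unless `−j ≤ i ≤ j`). -/
def IsTheta (m : MS) : Prop :=
  ∀ i j : ℤ, m (i, j) ≠ 0 → Odd i ∧ Odd j ∧ -j ≤ i ∧ i ≤ j ∧ 0 < m (i, j)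

/-- The pairs `(i,j)` in the box `[-N,N]²`, listed in decreasing PBW order,
i.e. decreasing lexicographic order in `(j,i)`. -/
def box (N : ℕ) : List (ℤ × ℤ) :=
  (List.range (2 * N + 1)).flatMap fun a =>
    (List.range (2 * N + 1)).map fun b => (((N : ℤ) - b, (N : ℤ) - a))

/-- A bound on the support of `m`. -/
def bound (m : MS) : ℕ := m.support.sup fun p => max p.1.natAbs p.2.natAbs

/-- The product of the modified divided powers `⟨i,j⟩^{[m_{i,j}]}` over the segments
appearing in `m`, in decreasing PBW order. -/
def PthetaProd (m : MS) : U := ((box (bound m)).map fun p => segPowM p.1 p.2 (m p)).prod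

/-- `P_θ(m)` for a θ-restricted multisegment `m`; it is `0` if `m` is not a
θ-restricted multisegment. -/
def Ptheta (m : MS) : U := if IsTheta m then PthetaProd m else 0

/-- The left ideal `Σ_k U_q^-(gl_∞)(f_k − f_{−k})` (over odd `k`). -/
def Jideal : Ideal U := Ideal.span {x : U | ∃ k : ℤ, Odd k ∧ x = fgen k - fgen (-k)}

/-- The quotient module `Ṽ_θ(0)`. -/
abbrev Vt : Type := U ⧸ Jideal

/-- The generator `φ̃ ∈ Ṽ_θ(0)`, image of `1`. -/
def phi : Vt := Submodule.Quotient.mk 1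

/-- The subring `A = ℚ[q, q⁻¹] ⊂ K`. -/
def Aring : Set K :=
  {x : K | ∃ (p : Polynomial ℚ) (n : ℕ), x = q ^ (-(n : ℤ)) * Polynomial.aeval q p}

/-- `U_q^-(gl_∞)_A`: the `A`-subalgebra of `U_q^-(gl_∞)` generated by the divided
powers `f_i^{(n)} = f_i^n/[n]!`, realized as the subring generated by `A·1` together
with the divided powers. -/
def UA : Subring U := Subring.closure
  ({x : U | ∃ c ∈ Aring, x = algebraMap K U c} ∪
   {x : U | ∃ (i : ℤ) (n : ℕ), Odd i ∧ x = (qfact n)⁻¹ • fgen i ^ n})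

/-- `V_θ(0)_A = U_q^-(gl_∞)_A · φ̃`. -/
def VA : Set Vt := {v : Vt | ∃ u ∈ UA, v = u • phi}

/-! ### Scalars -/

instance algebraNatK : Algebra ℕ K := Semiring.toNatAlgebra

instance algebraIntK : Algebra ℤ K := Ring.toIntAlgebra K

theorem q_ne_zero : q ≠ 0 := RatFunc.X_ne_zero

theorem q_pow_ne_one {n : ℕ} (hn : n ≠ 0) : q ^ n ≠ 1 := by
  intro h
  have h1 : algebraMap (Polynomial ℚ) (RatFunc ℚ) (Polynomial.X ^ n) =
      algebraMap (Polynomial ℚ) (RatFunc ℚ) 1 := by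
    rw [map_pow, RatFunc.algebraMap_X, map_one]; exact h
  have h2 := congrArg Polynomial.natDegree (RatFunc.algebraMap_injective ℚ h1)
  simp at h2
  exact hn h2

theorem q_zpow_ne_one {n : ℤ} (hn : n ≠ 0) : q ^ n ≠ 1 := by
  intro h
  obtain ⟨m, rfl | rfl⟩ := n.eq_nat_or_neg
  · exact q_pow_ne_one (n := m) (by simpa using hn) (by simpa using h)
  · exact q_pow_ne_one (n := m) (by simpa using hn) (by simpa using h)

theorem q_sub_inv_ne_zero : q - q⁻¹ ≠ 0 := by
  intro h
  apply q_zpow_ne_one (n := 2) (by norm_num)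
  have h1 : q = q⁻¹ := sub_eq_zero.1 h
  have h2 : q * q = 1 := by
    nth_rewrite 2 [h1]
    exact mul_inv_cancel₀ q_ne_zero
  rw [zpow_ofNat, sq, h2]

theorem one_sub_q_sq_ne_zero : 1 - q ^ 2 ≠ 0 := fun h =>
  q_pow_ne_one two_ne_zero (sub_eq_zero.1 h).symm

theorem one_add_q_zpow_ne_zero (n : ℤ) : 1 + q ^ n ≠ 0 := by
  intro h
  have h1 : q ^ n = -1 := by linear_combination h
  rcases eq_or_ne n 0 with rfl | hn
  · norm_num at h1
  · apply q_zpow_ne_one (n := n * 2) (by omega)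
    rw [zpow_mul, h1]; norm_num

theorem qint_ne_zero {n : ℤ} (hn : n ≠ 0) : qint n ≠ 0 := by
  refine div_ne_zero (fun h => ?_) q_sub_inv_ne_zero
  apply q_zpow_ne_one (n := n + n) (by omega)
  rw [zpow_add₀ q_ne_zero]
  nth_rewrite 1 [sub_eq_zero.1 h]
  rw [← zpow_add₀ q_ne_zero]; simp

theorem qint_zero : qint 0 = 0 := by simp [qint]

theorem qint_one : qint 1 = 1 := by
  simp only [qint, zpow_one, zpow_neg_one]
  exact div_self q_sub_inv_ne_zero

theorem qint_add (m n : ℤ) : qint (m + n) = q ^ n * qint m + q ^ (-m) * qint n := by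
  have := q_ne_zero
  simp only [qint, ← mul_div_assoc, ← add_div, neg_add, zpow_add₀ q_ne_zero]
  congr 1; ring

theorem qint_two_mul (n : ℤ) : qint (2 * n) = (q ^ n + q ^ (-n)) * qint n := by
  rw [two_mul, qint_add]; ring

/-- The subring `ℚ[q, q⁻¹]` of `K`. -/
def AA : Subring K where
  carrier := Aring
  one_mem' := ⟨1, 0, by simp⟩
  zero_mem' := ⟨0, 0, by simp⟩
  mul_mem' := by
    rintro _ _ ⟨p, m, rfl⟩ ⟨r, n, rfl⟩
    refine ⟨p * r, m + n, ?_⟩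
    rw [map_mul, Nat.cast_add, neg_add, zpow_add₀ q_ne_zero]; ring
  add_mem' := by
    rintro _ _ ⟨p, m, rfl⟩ ⟨r, n, rfl⟩
    refine ⟨Polynomial.X ^ n * p + Polynomial.X ^ m * r, m + n, ?_⟩
    have := q_ne_zero
    rw [map_add, map_mul, map_mul, map_pow, map_pow, Polynomial.aeval_X, Nat.cast_add, neg_add,
      zpow_add₀ q_ne_zero]
    simp only [zpow_neg, zpow_natCast]
    field_simp
  neg_mem' := by
    rintro _ ⟨p, m, rfl⟩
    exact ⟨-p, m, by rw [map_neg]; ring⟩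

theorem q_zpow_mem (n : ℤ) : q ^ n ∈ AA := by
  obtain ⟨m, rfl | rfl⟩ := n.eq_nat_or_neg
  · exact ⟨Polynomial.X ^ m, 0, by simp⟩
  · exact ⟨1, m, by simp⟩

/-- The product `[d] [2 * d] ⋯ [n * d]`. -/
def gfact (d : ℤ) (n : ℕ) : K := ∏ ν ∈ Finset.range n, qint (d * (ν + 1))

theorem gfact_zero (d : ℤ) : gfact d 0 = 1 := by simp [gfact]

theorem gfact_succ (d : ℤ) (n : ℕ) : gfact d (n + 1) = gfact d n * qint (d * (n + 1)) :=
  Finset.prod_range_succ _ _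

theorem gfact_ne_zero {d : ℤ} (hd : d ≠ 0) (n : ℕ) : gfact d n ≠ 0 :=
  Finset.prod_ne_zero_iff.2 fun ν _ => qint_ne_zero (mul_ne_zero hd (by positivity))

theorem qfact_eq_gfact (n : ℕ) : qfact n = gfact 1 n := by simp [qfact, gfact]

/-- The Gaussian binomial coefficient `[m+n]_d! / ([m]_d! [n]_d!)`. -/
def gbinom (d : ℤ) (m n : ℕ) : K := gfact d (m + n) / (gfact d m * gfact d n)

theorem gbinom_mem {d : ℤ} (hd : d ≠ 0) (m n : ℕ) : gbinom d m n ∈ AA := by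
  induction hk : m + n generalizing m n with
  | zero =>
    obtain ⟨rfl, rfl⟩ : m = 0 ∧ n = 0 := by omega
    simp [gbinom, gfact_zero, one_mem]
  | succ k ih =>
    rcases m with _ | m
    · simp [gbinom, gfact_zero, div_self (gfact_ne_zero hd n), one_mem]
    rcases n with _ | n
    · simp [gbinom, gfact_zero, div_self (gfact_ne_zero hd _), one_mem]
    have key : gbinom d (m + 1) (n + 1) =
        q ^ (d * (n + 1)) * gbinom d m (n + 1) + q ^ (-(d * (m + 1))) * gbinom d (m + 1) n := by
      have e : qint (d * ((m + 1 + n : ℕ) + 1)) = q ^ (d * (n + 1)) * qint (d * (m + 1))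
          + q ^ (-(d * (m + 1))) * qint (d * (n + 1)) := by
        rw [← qint_add]; congr 1; push_cast; ring
      have h1 := gfact_ne_zero hd m
      have h2 := gfact_ne_zero hd n
      have h3 : qint (d * (m + 1)) ≠ 0 := qint_ne_zero (mul_ne_zero hd (by positivity))
      have h4 : qint (d * (n + 1)) ≠ 0 := qint_ne_zero (mul_ne_zero hd (by positivity))
      have e1 : m + 1 + (n + 1) = m + 1 + n + 1 := by omega
      have e2 : m + (n + 1) = m + 1 + n := by omega
      simp only [gbinom]
      rw [e1, e2, gfact_succ d (m + 1 + n), gfact_succ d m, gfact_succ d n, e]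
      field_simp
    rw [key]
    exact add_mem (mul_mem (q_zpow_mem _) (ih _ _ (by omega)))
      (mul_mem (q_zpow_mem _) (ih _ _ (by omega)))

theorem gfact_two_div_mem (n : ℕ) : gfact 2 n / gfact 1 n ∈ AA := by
  induction n with
  | zero => simp [gfact_zero, one_mem]
  | succ n ih =>
    have h : gfact 2 (n + 1) / gfact 1 (n + 1) =
        gfact 2 n / gfact 1 n * (q ^ ((n : ℤ) + 1) + q ^ (-((n : ℤ) + 1))) := by
      have h1 := gfact_ne_zero one_ne_zero n
      have h3 : qint ((n : ℤ) + 1) ≠ 0 := qint_ne_zero (by positivity)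
      rw [gfact_succ, gfact_succ, qint_two_mul, one_mul]
      field_simp
    rw [h]
    exact mul_mem ih (add_mem (q_zpow_mem _) (q_zpow_mem _))

/-! ### Divided powers -/

section DividedPowers

variable {R : Type*} [Ring R] [Algebra K R]

/-- The divided power `x ^ n / ([d] [2 * d] ⋯ [n * d])`. -/
def gdp (d : ℤ) (x : R) (n : ℕ) : R := (gfact d n)⁻¹ • x ^ n

theorem gdp_zero (d : ℤ) (x : R) : gdp d x 0 = 1 := by simp [gdp, gfact_zero]

theorem mul_gdp {d : ℤ} (hd : d ≠ 0) (x : R) (n : ℕ) :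
    x * gdp d x n = qint (d * (n + 1)) • gdp d x (n + 1) := by
  have h3 : qint (d * ((n : ℤ) + 1)) ≠ 0 := qint_ne_zero (mul_ne_zero hd (by positivity))
  rw [gdp, gdp, mul_smul_comm, ← pow_succ', smul_smul, gfact_succ, mul_inv_rev, ← mul_assoc,
    mul_inv_cancel₀ h3, one_mul]

theorem gdp_mul_self {d : ℤ} (hd : d ≠ 0) (x : R) (n : ℕ) :
    gdp d x n * x = qint (d * (n + 1)) • gdp d x (n + 1) := by
  rw [← mul_gdp hd, gdp, mul_smul_comm, smul_mul_assoc, pow_mul_comm']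

theorem gdp_mul_gdp {d : ℤ} (hd : d ≠ 0) (x : R) (m n : ℕ) :
    gdp d x m * gdp d x n = gbinom d m n • gdp d x (m + n) := by
  have h := gfact_ne_zero hd (m + n)
  rw [gdp, gdp, gdp, smul_mul_smul_comm, ← pow_add, smul_smul, gbinom]
  congr 1
  field_simp

theorem gdp_one_eq_smul_gdp_two (x : R) (n : ℕ) :
    gdp 1 x n = (gfact 2 n / gfact 1 n) • gdp 2 x n := by
  have h := gfact_ne_zero two_ne_zero n
  rw [gdp, gdp, smul_smul]
  congr 1
  field_simp

theorem mul_pow_of_qcomm {x y : R} {c : K} (h : x * y = c • (y * x)) (n : ℕ) :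
    x * y ^ n = c ^ n • (y ^ n * x) := by
  induction n with
  | zero => simp
  | succ n ih =>
    rw [pow_succ, ← mul_assoc, ih, smul_mul_assoc, mul_assoc, h, mul_smul_comm, smul_smul, pow_succ,
      mul_assoc]

theorem pow_mul_of_qcomm {x y : R} {c : K} (h : x * y = c • (y * x)) (n : ℕ) :
    x ^ n * y = c ^ n • (y * x ^ n) := by
  induction n with
  | zero => simp
  | succ n ih =>
    rw [pow_succ, mul_assoc, h, mul_smul_comm, ← mul_assoc, ih, smul_mul_assoc, smul_smul,
      mul_assoc, ← pow_succ, mul_comm c, ← pow_succ]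

theorem mul_gdp_of_qcomm {x y : R} {c : K} (h : x * y = c • (y * x)) (d : ℤ) (n : ℕ) :
    x * gdp d y n = c ^ n • (gdp d y n * x) := by
  rw [gdp, mul_smul_comm, mul_pow_of_qcomm h, smul_mul_assoc, smul_comm]

theorem gdp_mul_of_qcomm {x y : R} {c : K} (h : x * y = c • (y * x)) (d : ℤ) (n : ℕ) :
    gdp d x n * y = c ^ n • (y * gdp d x n) := by
  rw [gdp, mul_smul_comm, smul_mul_assoc, pow_mul_of_qcomm h, smul_comm]

theorem gdp_mul_gdp_of_qcomm {x y : R} {c : K} (h : x * y = c • (y * x)) (d e : ℤ) (m n : ℕ) :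
    gdp d x m * gdp e y n = (c ^ m) ^ n • (gdp e y n * gdp d x m) :=
  mul_gdp_of_qcomm (gdp_mul_of_qcomm h d m) e n

theorem Commute.gdp_right {x y : R} (h : Commute x y) (d : ℤ) (n : ℕ) : Commute x (gdp d y n) :=
  (h.pow_right n).smul_right _

theorem Commute.gdp_left {x y : R} (h : Commute x y) (d : ℤ) (n : ℕ) : Commute (gdp d x n) y :=
  (h.symm.gdp_right d n).symm

/-- `Z` is the `q`-commutator of a pair `X, Y` satisfying the `q`-Serre relations. -/
structure SerrePair (X Y Z : R) : Prop where
  xy : X * Y = Z + q • (Y * X)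
  xz : X * Z = q⁻¹ • (Z * X)
  zy : Z * Y = q⁻¹ • (Y * Z)

theorem SerrePair.mul_pow {X Y Z : R} (h : SerrePair X Y Z) (m : ℕ) :
    X * Y ^ (m + 1) = q ^ (m + 1) • (Y ^ (m + 1) * X) + qint (m + 1) • (Y ^ m * Z) := by
  induction m with
  | zero => simp [h.xy, qint_one, add_comm]
  | succ m ih =>
    rw [pow_succ Y (m + 1), ← mul_assoc, ih, add_mul, smul_mul_assoc, smul_mul_assoc, mul_assoc, h.xy,
      mul_assoc (Y ^ m), h.zy]
    simp only [mul_add, mul_smul_comm, ← mul_assoc, ← pow_succ]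
    have e : qint (((m + 1 : ℕ) : ℤ) + 1) = q ^ (m + 1) + q⁻¹ * qint ((m : ℤ) + 1) := by
      rw [add_comm, qint_add, qint_one, zpow_neg_one, zpow_natCast]; push_cast; ring
    rw [e]
    module

/-- The one-step form of the straightening of divided powers in a `q`-Serre pair. -/
theorem SerrePair.mul_gdp {X Y Z : R} (h : SerrePair X Y Z) (m : ℕ) :
    X * gdp 1 Y (m + 1) = q ^ (m + 1) • (gdp 1 Y (m + 1) * X) + gdp 1 Y m * Z := by
  have h3 : qint ((m : ℤ) + 1) ≠ 0 := qint_ne_zero (by positivity)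
  rw [gdp, gdp, mul_smul_comm, h.mul_pow, smul_add, gfact_succ, one_mul, smul_mul_assoc,
    smul_mul_assoc]
  congr 1
  · rw [smul_comm]
  · rw [smul_smul]; congr 1; field_simp

theorem SerrePair.pow_mul {X Y Z : R} (h : SerrePair X Y Z) (m : ℕ) :
    X ^ (m + 1) * Y = q ^ (m + 1) • (Y * X ^ (m + 1)) + qint (m + 1) • (Z * X ^ m) := by
  induction m with
  | zero => simp [h.xy, qint_one, add_comm]
  | succ m ih =>
    rw [pow_succ' X (m + 1), mul_assoc, ih, mul_add, mul_smul_comm, mul_smul_comm, ← mul_assoc X Y,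
      h.xy, ← mul_assoc X Z, h.xz]
    simp only [add_mul, smul_mul_assoc, mul_assoc, ← pow_succ']
    have e : qint (((m + 1 : ℕ) : ℤ) + 1) = q ^ (m + 1) + q⁻¹ * qint ((m : ℤ) + 1) := by
      rw [add_comm, qint_add, qint_one, zpow_neg_one, zpow_natCast]; push_cast; ring
    rw [e]
    module

theorem SerrePair.gdp_mul_gdp {X Y Z : R} (h : SerrePair X Y Z) (n m : ℕ) :
    gdp 1 X n * gdp 1 Y m = ∑ p ∈ Finset.HasAntidiagonal.antidiagonal n,
      if p.1 ≤ m then q ^ ((p.2 : ℤ) * (m - p.1)) •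
        (gdp 1 Y (m - p.1) * gdp 1 Z p.1 * gdp 1 X p.2) else 0 := by
  set t : ℕ → ℕ → R := fun r k =>
    if r ≤ m then gdp 1 Y (m - r) * gdp 1 Z r * gdp 1 X k else 0 with ht
  have hstep : ∀ r k, X * t r k =
      (q ^ ((m : ℤ) - 2 * r) * qint (k + 1)) • t r (k + 1) + qint (r + 1) • t (r + 1) k := by
    intro r k
    by_cases hr : r ≤ m
    · obtain ⟨s, rfl⟩ := Nat.exists_eq_add_of_le hr
      have hX := _root_.mul_gdp one_ne_zero X k
      have hXZ := mul_gdp_of_qcomm h.xz 1 r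
      rw [one_mul] at hX
      have hz : q ^ (((r + s : ℕ) : ℤ) - 2 * r) = q ^ s * q⁻¹ ^ r := by
        rw [inv_pow, ← zpow_natCast, ← zpow_natCast, ← zpow_neg, ← zpow_add₀ q_ne_zero]
        congr 1; push_cast; ring
      rcases s with _ | s
      · simp only [ht, add_zero, le_refl, Nat.sub_self, gdp_zero, one_mul, if_true,
          Nat.not_succ_le_self, if_false, smul_zero]
        rw [← mul_assoc, hXZ, smul_mul_assoc, mul_assoc, hX, mul_smul_comm, smul_smul]
        rw [add_zero, pow_zero, one_mul] at hz
        rw [hz]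
      · have h1 : r + (s + 1) - r = s + 1 := by omega
        have h2 : r + (s + 1) - (r + 1) = s := by omega
        have hZ := _root_.mul_gdp one_ne_zero Z r
        rw [one_mul] at hZ
        simp only [ht, h1, h2, if_pos (show r ≤ r + (s + 1) by omega),
          if_pos (show r + 1 ≤ r + (s + 1) by omega)]
        rw [← mul_assoc, ← mul_assoc, h.mul_gdp, add_mul, smul_mul_assoc, mul_assoc _ X, hXZ, add_mul,
          mul_assoc _ Z, hZ, hz]
        simp only [mul_smul_comm, smul_mul_assoc, mul_assoc, hX, smul_smul]
    · simp [ht, hr, show ¬ r + 1 ≤ m by omega]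
  have hform : ∀ p : ℕ × ℕ, (if p.1 ≤ m then q ^ ((p.2 : ℤ) * (m - p.1)) •
        (gdp 1 Y (m - p.1) * gdp 1 Z p.1 * gdp 1 X p.2) else 0) =
        q ^ ((p.2 : ℤ) * (m - p.1)) • t p.1 p.2 := by
    intro p
    by_cases hp : p.1 ≤ m <;> simp [ht, hp]
  simp only [hform]
  induction n with
  | zero => simp [ht, gdp_zero]
  | succ n ih =>
    have hn : qint ((n : ℤ) + 1) ≠ 0 := qint_ne_zero (by positivity)
    have hX := _root_.mul_gdp one_ne_zero X n
    rw [one_mul] at hX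
    apply smul_right_injective R hn
    change qint ((n : ℤ) + 1) • _ = qint ((n : ℤ) + 1) • _
    rw [← smul_mul_assoc, ← hX, mul_assoc, ih, Finset.mul_sum, Finset.smul_sum]
    have hsplit : ∀ p ∈ Finset.HasAntidiagonal.antidiagonal (n + 1),
        qint ((n : ℤ) + 1) • q ^ ((p.2 : ℤ) * (m - p.1)) • t p.1 p.2 =
          (q ^ ((p.2 : ℤ) * (m - p.1) - p.1) * qint p.2) • t p.1 p.2 +
          (q ^ ((p.2 : ℤ) * (m - p.1) + p.2) * qint p.1) • t p.1 p.2 := by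
      intro p hp
      have hp' : p.1 + p.2 = n + 1 := Finset.HasAntidiagonal.mem_antidiagonal.1 hp
      have e : qint ((n : ℤ) + 1) = q ^ (p.2 : ℤ) * qint p.1 + q ^ (-(p.1 : ℤ)) * qint p.2 := by
        rw [← qint_add]; congr 1; exact_mod_cast hp'.symm
      rw [e, zpow_sub₀ q_ne_zero, zpow_add₀ q_ne_zero, zpow_neg]
      module
    rw [Finset.sum_congr rfl hsplit, Finset.sum_add_distrib, Finset.Nat.sum_antidiagonal_succ',
      Finset.Nat.sum_antidiagonal_succ]
    simp only [Nat.cast_zero, qint_zero, mul_zero, zero_smul, zero_add]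
    rw [← Finset.sum_add_distrib]
    refine Finset.sum_congr rfl fun p _ => ?_
    rw [mul_smul_comm, hstep, smul_add, smul_smul, smul_smul]
    congr 2
    · rw [← mul_assoc, ← zpow_add₀ q_ne_zero]
      push_cast
      congr 2; ring
    · push_cast
      congr 2; ring

end DividedPowers

/-! ### Segments in algebras satisfying the `q`-Serre relations -/

section Segments

variable {R : Type*} [Ring R] [Algebra K R]

/-- A family of elements satisfying the relations of `U_q^-(gl_∞)`. -/
structure SerreFamily (F : ℤ → R) : Prop where
  far : ∀ a b, 1 < |a - b| → Commute (F a) (F b)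
  serre : ∀ a b, |a - b| = 1 →
    q • (F a * F a * F b) + q • (F b * F a * F a) = (q ^ 2 + 1) • (F a * F b * F a)

/-- The segment `⟨a, a + n⟩` built on the family `F`. -/
def sgm (F : ℤ → R) (a : ℤ) : ℕ → R
  | 0 => F a
  | n + 1 => sgm F a n * F (a + n + 1) - q • (F (a + n + 1) * sgm F a n)

variable {F : ℤ → R}

theorem sgm_zero (a : ℤ) : sgm F a 0 = F a := rfl

theorem sgm_succ (a : ℤ) (n : ℕ) :
    sgm F a (n + 1) = sgm F a n * F (a + n + 1) - q • (F (a + n + 1) * sgm F a n) := rfl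

theorem commute_qbracket {x y z : R} (hy : Commute x y) (hz : Commute x z) :
    Commute x (y * z - q • (z * y)) :=
  (hy.mul_right hz).sub_right ((hz.mul_right hy).smul_right _)

namespace SerreFamily

variable (h : SerreFamily F)
include h

theorem commute_of_lt {a b : ℤ} (hab : a + 1 < b) : Commute (F a) (F b) :=
  h.far a b (by rw [abs_sub_comm, abs_of_nonneg] <;> omega)

theorem sgm_succ' (a : ℤ) (n : ℕ) :
    sgm F a (n + 1) = F a * sgm F (a + 1) n - q • (sgm F (a + 1) n * F a) := by
  induction n with
  | zero => simp [sgm]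
  | succ n ih =>
    have hc : F a * F (a + 1 + n + 1) = F (a + 1 + n + 1) * F a :=
      (h.commute_of_lt (by omega)).eq
    rw [sgm_succ, ih, sgm_succ (a + 1)]
    have e : a + (n + 1 : ℕ) + 1 = a + 1 + n + 1 := by push_cast; ring
    rw [e]
    generalize F (a + 1 + n + 1) = e at *
    generalize sgm F (a + 1) n = t
    generalize F a = f at *
    linear_combination (norm := (simp only [mul_add, add_mul, mul_sub, sub_mul, smul_mul_assoc,
      mul_smul_comm, mul_assoc]; module)) q • (hc * t) - q • (t * hc)

theorem commute_sgm_of_far {a c : ℤ} {n : ℕ} (hc : c + 1 < a ∨ a + n + 1 < c) :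
    Commute (F c) (sgm F a n) := by
  induction n with
  | zero =>
    rcases hc with hc | hc
    · exact h.commute_of_lt hc
    · exact (h.commute_of_lt (by push_cast at hc; omega)).symm
  | succ n ih =>
    refine commute_qbracket (ih (by omega)) ?_
    rcases hc with hc | hc
    · exact h.commute_of_lt (by omega)
    · exact (h.commute_of_lt (by push_cast at hc; omega)).symm

theorem commute_sgm_two (a : ℤ) : Commute (F (a + 1)) (sgm F a 2) := by
  have h1 := h.serre (a + 1) a (by simp)
  have h3 := h.serre (a + 1) (a + 1 + 1) (by simp)
  have hc : F (a + 1 + 1) * F a = F a * F (a + 1 + 1) := (h.commute_of_lt (by omega)).symm.eq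
  have hq : (q ^ 2 + 1 : K) ≠ 0 := by
    have := one_add_q_zpow_ne_zero 2
    rw [add_comm]; exact_mod_cast this
  rw [h.sgm_succ', h.sgm_succ', sgm_zero]
  generalize F (a + 1 + 1) = z at *
  generalize F (a + 1) = y at *
  generalize F a = x at *
  have hc' : ∀ w, z * (x * w) = x * (z * w) := fun w => by
    rw [← mul_assoc, hc, mul_assoc]
  refine smul_right_injective R hq ?_
  change (q ^ 2 + 1) • _ = (q ^ 2 + 1) • _
  linear_combination (norm := (simp only [mul_add, add_mul, mul_sub, sub_mul, smul_mul_assoc,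
      mul_smul_comm, mul_assoc, hc, hc']; module)) -(h1 * z) - q ^ 2 • (h3 * x) + x * h3
        + q ^ 2 • (z * h1)

theorem commute_sgm_of_mem {a c : ℤ} {n : ℕ} (h1 : a < c) (h2 : c < a + n) :
    Commute (F c) (sgm F a n) := by
  induction n generalizing a with
  | zero => push_cast at h2; omega
  | succ n ih =>
    push_cast at h2
    by_cases hn : c < a + n
    · exact commute_qbracket (ih h1 hn) (h.commute_of_lt (by omega))
    · by_cases hc : c = a + 1
      · obtain rfl : n = 1 := by omega
        exact hc ▸ h.commute_sgm_two a
      · rw [h.sgm_succ']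
        exact commute_qbracket (h.commute_of_lt (by omega)).symm (ih (by omega) (by omega))

theorem head_mul (a : ℤ) (n : ℕ) : F a * sgm F a (n + 1) = q⁻¹ • (sgm F a (n + 1) * F a) := by
  suffices H : q • (F a * sgm F a (n + 1)) = sgm F a (n + 1) * F a by
    rw [← H, inv_smul_smul₀ q_ne_zero]
  induction n with
  | zero =>
    have h1 := h.serre a (a + 1) (by simp)
    simp only [sgm_succ, sgm_zero, Nat.cast_zero, add_zero]
    linear_combination (norm := (simp only [mul_add, add_mul, mul_sub, sub_mul, smul_mul_assoc,
      mul_smul_comm, mul_assoc]; module)) h1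
  | succ n ih =>
    have hc : F a * F (a + (n + 1 : ℕ) + 1) = F (a + (n + 1 : ℕ) + 1) * F a :=
      (h.commute_of_lt (by push_cast; omega)).eq
    rw [sgm_succ]
    generalize F (a + (n + 1 : ℕ) + 1) = e at *
    generalize sgm F a (n + 1) = t at *
    linear_combination (norm := (simp only [mul_add, add_mul, mul_sub, sub_mul, smul_mul_assoc,
      mul_smul_comm, mul_assoc]; module)) ih * e - q • (e * ih) + t * hc - q ^ 2 • (hc * t)

theorem mul_tail (a : ℤ) (n : ℕ) :
    sgm F a (n + 1) * F (a + n + 1) = q⁻¹ • (F (a + n + 1) * sgm F a (n + 1)) := by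
  suffices H : q • (sgm F a (n + 1) * F (a + n + 1)) = F (a + n + 1) * sgm F a (n + 1) by
    rw [← H, inv_smul_smul₀ q_ne_zero]
  induction n generalizing a with
  | zero =>
    have h1 := h.serre (a + 1) a (by simp)
    simp only [sgm_succ, sgm_zero, Nat.cast_zero, add_zero]
    linear_combination (norm := (simp only [mul_add, add_mul, mul_sub, sub_mul, smul_mul_assoc,
      mul_smul_comm, mul_assoc]; module)) h1
  | succ n ih =>
    have e : a + (n + 1 : ℕ) + 1 = a + 1 + n + 1 := by push_cast; ring
    rw [e]
    have hc : F a * F (a + 1 + n + 1) = F (a + 1 + n + 1) * F a :=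
      (h.commute_of_lt (by omega)).eq
    have ih := ih (a + 1)
    rw [h.sgm_succ']
    generalize F (a + 1 + n + 1) = e at *
    generalize sgm F (a + 1) (n + 1) = t at *
    linear_combination (norm := (simp only [mul_add, add_mul, mul_sub, sub_mul, smul_mul_assoc,
      mul_smul_comm, mul_assoc]; module)) F a * ih - q • (ih * F a) - q ^ 2 • (t * hc) + hc * t

theorem sgm_mul_sgm_right (a : ℤ) (k n : ℕ) :
    sgm F a (n + (k + 1)) * sgm F (a + k + 1) n =
      q⁻¹ • (sgm F (a + k + 1) n * sgm F a (n + (k + 1))) := by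
  induction n generalizing k with
  | zero => rw [zero_add, sgm_zero]; exact h.mul_tail a k
  | succ n ih =>
    have hc : F (a + k + 1) * sgm F a (n + 1 + (k + 1)) = sgm F a (n + 1 + (k + 1)) * F (a + k + 1) :=
      (h.commute_sgm_of_mem (by omega) (by push_cast; omega)).eq
    have ih := ih (k + 1)
    have e : a + (k + 1 : ℕ) + 1 = a + k + 1 + 1 := by push_cast; ring
    have e' : n + (k + 1 + 1) = n + 1 + (k + 1) := by ring
    rw [e, e'] at ih
    rw [h.sgm_succ' (a + k + 1) n]
    generalize sgm F a (n + 1 + (k + 1)) = z at *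
    generalize sgm F (a + k + 1 + 1) n = t at *
    generalize F (a + k + 1) = f at *
    linear_combination (norm := (simp only [mul_add, add_mul, mul_sub, sub_mul, smul_mul_assoc,
      mul_smul_comm, mul_assoc]; module)) -(hc * t) - q • (ih * f) + f * ih + (q * q⁻¹) • (t * hc)

theorem sgm_mul_sgm_left (a : ℤ) (k n : ℕ) :
    sgm F a n * sgm F a (n + (k + 1)) = q⁻¹ • (sgm F a (n + (k + 1)) * sgm F a n) := by
  induction n generalizing k with
  | zero => rw [zero_add, sgm_zero]; exact h.head_mul a k
  | succ n ih =>
    have hc : F (a + n + 1) * sgm F a (n + 1 + (k + 1)) = sgm F a (n + 1 + (k + 1)) * F (a + n + 1) :=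
      (h.commute_sgm_of_mem (by omega) (by push_cast; omega)).eq
    have ih := ih (k + 1)
    have e' : n + (k + 1 + 1) = n + 1 + (k + 1) := by ring
    rw [e'] at ih
    rw [sgm_succ a n]
    generalize sgm F a (n + 1 + (k + 1)) = z at *
    generalize sgm F a n = t at *
    generalize F (a + n + 1) = f at *
    linear_combination (norm := (simp only [mul_add, add_mul, mul_sub, sub_mul, smul_mul_assoc,
      mul_smul_comm, mul_assoc]; module)) ih * f + t * hc - q • (f * ih) - (q * q⁻¹) • (hc * t)

theorem serrePair_head (a : ℤ) (n : ℕ) : SerrePair (F a) (sgm F (a + 1) n) (sgm F a (n + 1)) where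
  xy := by rw [h.sgm_succ']; simp
  xz := h.head_mul a n
  zy := by simpa using h.sgm_mul_sgm_right a 0 n

theorem serrePair_tail (a : ℤ) (n : ℕ) : SerrePair (sgm F a n) (F (a + n + 1)) (sgm F a (n + 1)) where
  xy := by rw [sgm_succ]; simp
  xz := by simpa using h.sgm_mul_sgm_left a 0 n
  zy := h.mul_tail a n

variable {V : Type*} [AddCommGroup V] [Module K V] [Module R V] [IsScalarTower K R V]

/-- On a vector fixed by `F a ↦ F (-1 - a)`, a segment acts up to a power of `q` as its mirror
image. -/
theorem sgm_smul_eq_mirror {v : V} (hv : ∀ a, F a • v = F (-1 - a) • v) (N m : ℕ) (hN : 1 ≤ N)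
    (hm : m ≤ 2 * N) : sgm F (-1 - N) m • v = (if m ≤ N then (1 : K) else q⁻¹) • sgm F (N - m) m • v := by
  induction m with
  | zero => simpa [sgm_zero] using hv (-1 - N)
  | succ m ih =>
    have ih := ih (by omega)
    have e1 : (-1 - N : ℤ) + m + 1 = m - N := by ring
    have e2 : ((N : ℤ) - (m + 1 : ℕ)) + 1 = N - m := by push_cast; ring
    have hv1 : F (m - N) • v = F (N - (m + 1 : ℕ)) • v := by
      rw [hv]; congr 2; push_cast; ring
    rw [sgm_succ, h.sgm_succ', e1, e2, sub_smul, sub_smul, mul_smul, mul_smul, smul_assoc, smul_assoc,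
      mul_smul, mul_smul, ih, hv1]
    rcases lt_trichotomy m N with hmN | rfl | hmN
    · have c1 : Commute (F (N - (m + 1 : ℕ))) (sgm F (-1 - N) m) :=
        h.commute_sgm_of_far (by push_cast; omega)
      have c2 : F (m - N) • sgm F (N - m) m • v = sgm F (N - m) m • F (m - N) • v := by
        rw [← mul_smul, (h.commute_sgm_of_far (by push_cast; omega)).eq, mul_smul]
      rw [← mul_smul, ← c1.eq, mul_smul, ih, if_pos (by omega), if_pos (by omega), one_smul, one_smul,
        c2, hv1]
    · obtain ⟨k, rfl⟩ : ∃ k, m = k + 1 := ⟨m - 1, by omega⟩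
      have c1 := h.mul_tail (-1 - (k + 1 : ℕ)) k
      have c2 : F 0 • sgm F 0 (k + 1) • v = q⁻¹ • sgm F 0 (k + 1) • F 0 • v := by
        rw [← mul_smul, h.head_mul 0 k, smul_assoc, mul_smul]
      have e3 : (-1 - (k + 1 : ℕ) + k + 1 : ℤ) = (k + 1 : ℕ) - (k + 1 + 1 : ℕ) := by
        push_cast; ring
      rw [e3] at c1
      rw [sub_self] at *
      rw [← mul_smul, c1, smul_assoc, mul_smul, ih, if_pos le_rfl, if_neg (by omega), one_smul,
        c2, hv1]
      rw [smul_sub, smul_comm q q⁻¹]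
    · have c1 : Commute (F (N - (m + 1 : ℕ))) (sgm F (-1 - N) m) :=
        h.commute_sgm_of_mem (by push_cast; omega) (by push_cast; omega)
      have c2 : F (m - N) • sgm F (N - m) m • v = sgm F (N - m) m • F (m - N) • v := by
        rw [← mul_smul, (h.commute_sgm_of_mem (by omega) (by omega)).eq, mul_smul]
      rw [← mul_smul, ← c1.eq, mul_smul, ih, if_neg (by omega), if_neg (by omega),
        smul_comm (F ((m : ℤ) - N)) (q⁻¹ : K) (sgm F _ _ • v), c2, hv1,
        smul_comm (F ((N : ℤ) - _)) (q⁻¹ : K) (sgm F _ _ • v)]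
      rw [smul_sub, smul_comm q q⁻¹]

end SerreFamily

end Segments

/-! ### Straightening divided powers acting on the cyclic vector -/

section Straightening

variable {R : Type*} [Ring R] [Algebra K R]

/-- The triples `(s, t, p)` with `s + t + 2 * p = n`. -/
def triples (n : ℕ) : Finset (ℕ × ℕ × ℕ) :=
  (Finset.range (n + 1) ×ˢ Finset.range (n + 1) ×ˢ Finset.range (n + 1)).filter
    fun i => i.1 + i.2.1 + 2 * i.2.2 = n

theorem mem_triples {n : ℕ} {i : ℕ × ℕ × ℕ} : i ∈ triples n ↔ i.1 + i.2.1 + 2 * i.2.2 = n := by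
  simp only [triples, Finset.mem_filter, Finset.mem_product, Finset.mem_range]
  omega

/-- The monomials `y^{(s)} z^{(t)} W^{[p]}`. -/
def mon3 (y z W : R) (s t p : ℕ) : R := gdp 1 y s * gdp 1 z t * gdp 2 W p

section

variable {x y z W : R}

theorem mon3_mul_left (hWy : W * y = q⁻¹ • (y * W)) (hzy : z * y = q⁻¹ • (y * z)) (s t p : ℕ) :
    mon3 y z W s t p * y = (q ^ (-(p : ℤ) - t) * qint (s + 1)) • mon3 y z W (s + 1) t p := by
  have h1 := gdp_mul_self one_ne_zero y s
  rw [one_mul] at h1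
  rw [mon3, mul_assoc, gdp_mul_of_qcomm hWy, mul_smul_comm, ← mul_assoc, mul_assoc _ _ y,
    gdp_mul_of_qcomm hzy, mul_smul_comm, ← mul_assoc, h1, mon3]
  simp only [smul_mul_assoc, smul_smul]
  congr 1
  rw [zpow_sub₀ q_ne_zero, zpow_neg, zpow_natCast, zpow_natCast, inv_pow, inv_pow]
  ring

theorem mon3_mul_mid (hWz : W * z = q⁻¹ • (z * W)) (s t p : ℕ) :
    mon3 y z W s t p * z = (q ^ (-(p : ℤ)) * qint (t + 1)) • mon3 y z W s (t + 1) p := by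
  have h1 := gdp_mul_self one_ne_zero z t
  rw [one_mul] at h1
  rw [mon3, mul_assoc, gdp_mul_of_qcomm hWz, mul_smul_comm, ← mul_assoc, mul_assoc _ _ z, h1, mon3]
  simp only [smul_mul_assoc, mul_smul_comm, smul_smul]
  rw [zpow_neg, zpow_natCast, inv_pow]

theorem mul_mon3 (hxy : Commute x y) (hxz : SerrePair x z W) (s t p : ℕ) :
    x * mon3 y z W s t p = q ^ ((t : ℤ) - p) • (mon3 y z W s t p * x) +
      if t = 0 then 0 else qint (2 * (p + 1)) • mon3 y z W s (t - 1) (p + 1) := by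
  have h1 : x * gdp 2 W p = q⁻¹ ^ p • (gdp 2 W p * x) := mul_gdp_of_qcomm hxz.xz 2 p
  rw [mon3, ← mul_assoc, ← mul_assoc, (hxy.gdp_right 1 s).eq, mul_assoc _ x]
  rcases t with _ | t
  · simp only [gdp_zero, mul_one, mul_assoc, h1, mul_smul_comm]
    simp
  · rw [hxz.mul_gdp, mul_add, add_mul, if_neg (Nat.succ_ne_zero t)]
    congr 1
    · simp only [mul_assoc, mul_smul_comm, smul_mul_assoc, h1, smul_smul]
      congr 1
      rw [zpow_sub₀ q_ne_zero, zpow_natCast, zpow_natCast, inv_pow, div_eq_mul_inv]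
    · rw [← mul_assoc, mul_assoc _ W, mul_gdp two_ne_zero, mul_smul_comm, mon3,
        Nat.add_sub_cancel]

variable {V : Type*} [AddCommGroup V] [Module K V] [Module R V] [IsScalarTower K R V]

theorem gdp_smul_straighten (hxy : Commute x y) (hxz : SerrePair x z W)
    (hWy : W * y = q⁻¹ • (y * W)) (hzy : z * y = q⁻¹ • (y * z)) (hWz : W * z = q⁻¹ • (z * W))
    {d : ℤ → V} (hd : ∀ c, x • d c = q ^ (2 * c) • y • d c + z • d (c - 1)) (b : ℤ) (n : ℕ) :
    gdp 1 x n • d b = ∑ i ∈ triples n,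
      q ^ ((i.1 : ℤ) * (2 * b - i.2.1 - 2 * i.2.2) + (i.2.1.choose 2 : ℕ)) •
        mon3 y z W i.1 i.2.1 i.2.2 • d (b - i.2.1 - i.2.2) := by
  set C : ℕ × ℕ × ℕ → K := fun i =>
    q ^ ((i.1 : ℤ) * (2 * b - i.2.1 - 2 * i.2.2) + (i.2.1.choose 2 : ℕ)) with hC
  set S : ℕ × ℕ × ℕ → V := fun i => mon3 y z W i.1 i.2.1 i.2.2 • d (b - i.2.1 - i.2.2) with hS
  change _ = ∑ i ∈ triples n, C i • S i
  have hx : ∀ s t p : ℕ, x • S (s, t, p) =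
      (q ^ (2 * b - 2 * t - 4 * p) * qint (s + 1)) • S (s + 1, t, p) +
      (q ^ ((t : ℤ) - 2 * p) * qint (t + 1)) • S (s, t + 1, p) +
      if t = 0 then 0 else qint (2 * (p + 1)) • S (s, t - 1, p + 1) := by
    intro s t p
    simp only [hS]
    rw [← mul_smul, mul_mon3 hxy hxz, add_smul, smul_assoc, mul_smul, hd, smul_add,
      smul_comm (mon3 y z W s t p) (q ^ _ : K), ← mul_smul _ y, ← mul_smul _ z,
      mon3_mul_left hWy hzy, mon3_mul_mid hWz, smul_add]
    congr 1
    · congr 1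
      · simp only [smul_assoc, smul_smul]
        rw [← mul_assoc, ← mul_assoc, ← zpow_add₀ q_ne_zero, ← zpow_add₀ q_ne_zero]
        congr 3; ring
      · simp only [smul_assoc, smul_smul]
        rw [← mul_assoc, ← zpow_add₀ q_ne_zero]
        congr 3
        · ring
        · push_cast; ring
    · split_ifs with ht
      · simp
      · rw [smul_assoc]
        congr 3
        push_cast [Nat.one_le_iff_ne_zero.2 ht]; ring
  induction n with
  | zero =>
    have : triples 0 = {(0, 0, 0)} := by
      ext ⟨s, t, p⟩; simp only [mem_triples, Finset.mem_singleton, Prod.mk.injEq]; omega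
    simp [this, hC, hS, mon3, gdp_zero]
  | succ n ih =>
    have hn : qint ((n : ℤ) + 1) ≠ 0 := qint_ne_zero (by positivity)
    have hX := mul_gdp one_ne_zero x n
    rw [one_mul] at hX
    apply smul_right_injective V hn
    change qint ((n : ℤ) + 1) • _ = qint ((n : ℤ) + 1) • _
    rw [← smul_assoc, ← hX, mul_smul, ih, Finset.smul_sum, Finset.smul_sum]
    have hsplit : ∀ i ∈ triples (n + 1), qint ((n : ℤ) + 1) • C i • S i =
        (q ^ (-(i.2.1 : ℤ) - 2 * i.2.2) * qint i.1 * C i) • S i +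
        (q ^ ((i.1 : ℤ) - 2 * i.2.2) * qint i.2.1 * C i) • S i +
        (q ^ ((i.1 : ℤ) + i.2.1) * qint (2 * i.2.2) * C i) • S i := by
      rintro ⟨s, t, p⟩ hi
      rw [mem_triples] at hi
      have e : qint ((n : ℤ) + 1) = q ^ (-(t : ℤ) - 2 * p) * qint s + q ^ ((s : ℤ) - 2 * p) * qint t
          + q ^ ((s : ℤ) + t) * qint (2 * p) := by
        have : (n : ℤ) + 1 = (t + 2 * p) + s := by
          simp only at hi; push_cast [← Int.natCast_inj] at hi; omega
        rw [this, qint_add _ (s : ℤ), add_comm (t : ℤ), qint_add]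
        simp only [sub_eq_add_neg, zpow_add₀ q_ne_zero, neg_add]
        ring
      rw [← add_smul, ← add_smul, smul_smul, e]
      congr 1; ring
    rw [Finset.sum_congr rfl hsplit, Finset.sum_add_distrib, Finset.sum_add_distrib]
    have hsum : ∀ i ∈ triples n, x • C i • S i =
        (C i * (q ^ (2 * b - 2 * i.2.1 - 4 * i.2.2) * qint (i.1 + 1))) • S (i.1 + 1, i.2.1, i.2.2) +
        (C i * (q ^ ((i.2.1 : ℤ) - 2 * i.2.2) * qint (i.2.1 + 1))) • S (i.1, i.2.1 + 1, i.2.2) +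
        if i.2.1 = 0 then 0 else
          (C i * qint (2 * (i.2.2 + 1))) • S (i.1, i.2.1 - 1, i.2.2 + 1) := by
      rintro ⟨s, t, p⟩ -
      rw [smul_comm, hx, smul_add, smul_add, smul_smul, smul_smul]
      congr 1
      split_ifs <;> simp [smul_smul]
    rw [Finset.sum_congr rfl hsum, Finset.sum_add_distrib, Finset.sum_add_distrib]
    congr 1
    · congr 1
      · refine Finset.sum_of_injOn (fun i => (i.1 + 1, i.2.1, i.2.2)) ?_ ?_ ?_ ?_
        · rintro ⟨s, t, p⟩ - ⟨s', t', p'⟩ - h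
          simpa using h
        · rintro ⟨s, t, p⟩ h
          simp only [Finset.mem_coe, mem_triples] at h ⊢
          omega
        · rintro ⟨s, t, p⟩ h h'
          rcases s with _ | s
          · simp [qint_zero]
          · refine (h' ⟨(s, t, p), ?_, rfl⟩).elim
            simp only [Finset.mem_coe, mem_triples] at h ⊢
            omega
        · rintro ⟨s, t, p⟩ -
          congr 1
          simp only [hC]
          rw [mul_right_comm, ← zpow_add₀ q_ne_zero, ← mul_assoc, ← zpow_add₀ q_ne_zero]
          push_cast
          congr 2; ring
      · refine Finset.sum_of_injOn (fun i => (i.1, i.2.1 + 1, i.2.2)) ?_ ?_ ?_ ?_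
        · rintro ⟨s, t, p⟩ - ⟨s', t', p'⟩ - h
          simpa using h
        · rintro ⟨s, t, p⟩ h
          simp only [Finset.mem_coe, mem_triples] at h ⊢
          omega
        · rintro ⟨s, t, p⟩ h h'
          rcases t with _ | t
          · simp [qint_zero]
          · refine (h' ⟨(s, t, p), ?_, rfl⟩).elim
            simp only [Finset.mem_coe, mem_triples] at h ⊢
            omega
        · rintro ⟨s, t, p⟩ -
          congr 1
          simp only [hC]
          rw [mul_right_comm, ← zpow_add₀ q_ne_zero, ← mul_assoc, ← zpow_add₀ q_ne_zero,
            Nat.choose_succ_succ' t 1, Nat.choose_one_right]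
          push_cast
          congr 2; ring
    · rw [Finset.sum_ite, Finset.sum_const_zero, zero_add]
      refine Finset.sum_of_injOn (fun i => (i.1, i.2.1 - 1, i.2.2 + 1)) ?_ ?_ ?_ ?_
      · rintro ⟨s, t, p⟩ h1 ⟨s', t', p'⟩ h2 h
        simp only [Finset.coe_filter, Set.mem_setOf_eq, Prod.mk.injEq] at h1 h2 h ⊢
        omega
      · rintro ⟨s, t, p⟩ h
        simp only [Finset.coe_filter, Set.mem_setOf_eq, Finset.mem_coe, mem_triples] at h ⊢
        omega
      · rintro ⟨s, t, p⟩ h h'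
        rcases p with _ | p
        · simp [qint_zero]
        · refine (h' ⟨(s, t + 1, p), ?_, rfl⟩).elim
          simp only [Finset.coe_filter, Set.mem_setOf_eq, mem_triples] at h ⊢
          omega
      · rintro ⟨s, t, p⟩ h
        obtain ⟨t, rfl⟩ := Nat.exists_eq_succ_of_ne_zero (Finset.mem_filter.1 h).2
        congr 1
        simp only [hC, Nat.succ_eq_add_one, Nat.add_sub_cancel]
        rw [mul_right_comm, ← zpow_add₀ q_ne_zero, mul_comm (q ^ _ : K), Nat.choose_succ_succ' t 1,
          Nat.choose_one_right, mul_comm]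
        push_cast
        congr 2; ring

end

end Straightening

section Straightening

variable {R : Type*} [Ring R] [Algebra K R]
variable {V : Type*} [AddCommGroup V] [Module K V] [Module R V] [IsScalarTower K R V]

/-- The vectors `D^{[c]} v`, extended by zero to negative `c`. -/
def gdpVec (D : R) (v : V) (c : ℤ) : V := if c < 0 then 0 else gdp 2 D c.toNat • v

theorem smul_gdpVec {x y z D w : R} {v : V} (hxD : SerrePair x D w) (hDy : SerrePair D y z)
    (hxv : x • v = y • v) (hwv : w • v = q⁻¹ • z • v) (c : ℤ) :
    x • gdpVec D v c = q ^ (2 * c) • y • gdpVec D v c + z • gdpVec D v (c - 1) := by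
  rcases lt_or_ge c 0 with hc | hc
  · simp [gdpVec, hc, show c - 1 < 0 by omega]
  obtain ⟨n, rfl⟩ := Int.eq_ofNat_of_zero_le hc
  rcases n with _ | n
  · simp [gdpVec, gdp_zero, hxv]
  have e1 : ((n + 1 : ℕ) : ℤ) - 1 = n := by push_cast; ring
  have e2 : ¬ ((n : ℕ) : ℤ) < 0 := by omega
  have e3 : ¬ ((n + 1 : ℕ) : ℤ) < 0 := by omega
  rw [e1, gdpVec, gdpVec, if_neg e2, if_neg e3, Int.toNat_natCast, Int.toNat_natCast]
  have hz : D ^ n * z = q⁻¹ ^ n • (z * D ^ n) := pow_mul_of_qcomm hDy.xz n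
  have key : x • D ^ (n + 1) • v = q ^ (2 * (n + 1)) • y • D ^ (n + 1) • v +
      qint (2 * (n + 1)) • z • D ^ n • v := by
    rw [← mul_smul x, hxD.mul_pow, add_smul, smul_assoc, smul_assoc, mul_smul, mul_smul, hxv, hwv,
      ← mul_smul _ y, hDy.pow_mul, add_smul, smul_assoc, smul_assoc, mul_smul y, mul_smul z,
      smul_comm (D ^ n) q⁻¹, ← mul_smul _ z, hz, smul_assoc, mul_smul z, qint_two_mul]
    have e4 : q ^ ((n : ℤ) + 1) = q ^ (n + 1) := by
      rw [← zpow_natCast]; push_cast; rfl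
    have e5 : q ^ (-((n : ℤ) + 1)) = q⁻¹ * q⁻¹ ^ n := by
      rw [zpow_neg, e4, ← inv_pow, pow_succ']
    have e6 : qint ((n + 1 : ℕ) : ℤ) = qint ((n : ℤ) + 1) := by push_cast; rfl
    rw [e4, e5]
    simp only [smul_add, smul_smul, add_assoc]
    rw [← add_smul]
    congr 2 <;> ring
  have h3 : qint (2 * ((n : ℤ) + 1)) ≠ 0 := qint_ne_zero (by positivity)
  rw [gdp, gdp, smul_assoc, smul_assoc, smul_comm x (_ : K), key, gfact_succ, smul_comm y (_ : K),
    smul_comm z (_ : K), smul_add]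
  congr 1
  · rw [smul_comm, ← zpow_natCast]; push_cast; rfl
  · rw [smul_smul]; congr 1; field_simp

end Straightening

/-! ### Integral spanning -/

section Integral

variable {R : Type*} [Ring R] [Algebra K R]

theorem SerrePair.gdp_mem {X Y Z : R} (h : SerrePair X Y Z) {S : Subring R}
    (hA : ∀ c ∈ AA, algebraMap K R c ∈ S) (hX : ∀ n, gdp 1 X n ∈ S) (hY : ∀ n, gdp 1 Y n ∈ S)
    (n : ℕ) : gdp 1 Z n ∈ S := by
  induction n using Nat.strong_induction_on with
  | _ n ih =>
    have h1 := h.gdp_mul_gdp n n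
    rw [← Finset.add_sum_erase _ _ (Finset.HasAntidiagonal.mem_antidiagonal.2
      (add_zero n) : ((n, 0) : ℕ × ℕ) ∈ _)] at h1
    simp only [le_refl, if_true, Nat.sub_self, gdp_zero, one_mul, mul_one, Nat.cast_zero, zero_mul,
      zpow_zero, one_smul] at h1
    rw [← sub_eq_iff_eq_add] at h1
    rw [← h1]
    refine sub_mem (mul_mem (hX n) (hY n)) (sum_mem fun p hp => ?_)
    obtain ⟨hp1, hp2⟩ := Finset.mem_erase.1 hp
    rw [Finset.HasAntidiagonal.mem_antidiagonal] at hp2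
    have hlt : p.1 < n := by
      rcases p with ⟨r, k⟩
      simp only [ne_eq, Prod.mk.injEq, not_and] at hp1 hp2 ⊢
      omega
    rw [if_pos hlt.le, Algebra.smul_def]
    exact mul_mem (hA _ (q_zpow_mem _)) (mul_mem (mul_mem (hY _) (ih _ hlt)) (hX _))

/-- The integral form of the subalgebra generated by `F a` for `-N ≤ a < N`. -/
def intSubring (F : ℤ → R) (N : ℕ) : Subring R := Subring.closure
  ({x | ∃ c ∈ AA, x = algebraMap K R c} ∪ {x | ∃ (a : ℤ) (n : ℕ), -N ≤ a ∧ a < N ∧ x = gdp 1 (F a) n})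

variable {F : ℤ → R}

theorem algebraMap_mem_intSubring (N : ℕ) {c : K} (hc : c ∈ AA) :
    algebraMap K R c ∈ intSubring F N :=
  Subring.subset_closure (Or.inl ⟨c, hc, rfl⟩)

theorem gdp_mem_intSubring {N : ℕ} {a : ℤ} (h1 : -N ≤ a) (h2 : a < N) (n : ℕ) :
    gdp 1 (F a) n ∈ intSubring F N :=
  Subring.subset_closure (Or.inr ⟨a, n, h1, h2, rfl⟩)

theorem intSubring_mono {N M : ℕ} (h : N ≤ M) : intSubring F N ≤ intSubring F M := by
  refine Subring.closure_le.2 ?_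
  rintro x (⟨c, hc, rfl⟩ | ⟨a, n, h1, h2, rfl⟩)
  · exact algebraMap_mem_intSubring M hc
  · exact gdp_mem_intSubring (by omega) (by omega) n

theorem commute_of_mem_intSubring {N : ℕ} {x u : R} (hx : ∀ a : ℤ, -N ≤ a → a < N → Commute x (F a))
    (hu : u ∈ intSubring F N) : Commute x u := by
  induction hu using Subring.closure_induction with
  | mem u hu =>
    rcases hu with ⟨c, hc, rfl⟩ | ⟨a, n, h1, h2, rfl⟩
    · exact (Algebra.commutes c x).symm
    · exact (hx a h1 h2).gdp_right 1 n
  | zero => exact Commute.zero_right x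
  | one => exact Commute.one_right x
  | add _ _ _ _ h1 h2 => exact h1.add_right h2
  | mul _ _ _ _ h1 h2 => exact h1.mul_right h2
  | neg _ _ h1 => exact h1.neg_right

theorem SerreFamily.gdp_sgm_mem (h : SerreFamily F) {N : ℕ} {a : ℤ} {k : ℕ} (h1 : -N ≤ a)
    (h2 : a + k < N) (n : ℕ) : gdp 1 (sgm F a k) n ∈ intSubring F N := by
  induction k generalizing n with
  | zero => exact gdp_mem_intSubring h1 (by simpa using h2) n
  | succ k ih =>
    push_cast at h2
    exact (h.serrePair_tail a k).gdp_mem (fun c hc => algebraMap_mem_intSubring N hc)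
      (ih (by omega)) (gdp_mem_intSubring (by omega) (by omega)) n

/-- The segments `⟨N - j, N⟩` ending at `N`. -/
def col (F : ℤ → R) (N j : ℕ) : R := sgm F (N - j) j

/-- The modified divided powers of the segments ending at `N`. -/
def colPow (F : ℤ → R) (N j n : ℕ) : R := gdp (if j = 2 * N + 1 then 2 else 1) (col F N j) n

theorem colPow_of_lt {N j : ℕ} (hj : j < 2 * N + 1) (n : ℕ) : colPow F N j n = gdp 1 (col F N j) n := by
  rw [colPow, if_neg hj.ne]

theorem colPow_last (N n : ℕ) : colPow F N (2 * N + 1) n = gdp 2 (col F N (2 * N + 1)) n := by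
  rw [colPow, if_pos rfl]

theorem colPow_zero (N j : ℕ) : colPow F N j 0 = 1 := gdp_zero _ _

namespace SerreFamily

variable (h : SerreFamily F)
include h

theorem col_mul_col {N i j : ℕ} (hij : i < j) :
    col F N j * col F N i = q⁻¹ • (col F N i * col F N j) := by
  obtain ⟨k, rfl⟩ := Nat.exists_eq_add_of_lt hij
  have := h.sgm_mul_sgm_right (N - (i + k + 1 : ℕ)) k i
  have e : (N : ℤ) - (i + k + 1 : ℕ) + k + 1 = N - i := by push_cast; ring
  rwa [e, ← add_assoc] at this

theorem commute_col {N i j : ℕ} (h1 : i ≠ j) (h2 : i + 1 ≠ j) :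
    Commute (F (N - i - 1)) (col F N j) := by
  rcases lt_or_gt_of_ne h1 with h3 | h3
  · exact h.commute_sgm_of_mem (by omega) (by omega)
  · exact h.commute_sgm_of_far (by omega)

theorem serrePair_col (N j : ℕ) : SerrePair (F (N - j - 1)) (col F N j) (col F N (j + 1)) := by
  have := h.serrePair_head ((N : ℤ) - j - 1) j
  rw [sub_add_cancel] at this
  rw [col, col]
  convert this using 2
  push_cast; ring

theorem mul_col (N j : ℕ) :
    F (N - j - 1) * col F N (j + 1) = q⁻¹ • (col F N (j + 1) * F (N - j - 1)) :=
  (h.serrePair_col N j).xz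

end SerreFamily

variable {V : Type*} [AddCommGroup V] [Module K V] [Module R V] [IsScalarTower K R V]

theorem smul_mem_of_mem_span {s : Set V} {M : Submodule AA V} {x : R} (hx : ∀ w ∈ s, x • w ∈ M) {w : V}
    (hw : w ∈ Submodule.span AA s) : x • w ∈ M := by
  induction hw using Submodule.span_induction with
  | mem w hw => exact hx w hw
  | zero => rw [smul_zero]; exact zero_mem _
  | add _ _ _ _ h1 h2 => rw [smul_add]; exact add_mem h1 h2
  | smul c w _ hw =>
    rw [Subring.smul_def, smul_comm x (c : K) w]
    exact M.smul_mem c hw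

theorem AA_smul_mem {M : Submodule AA V} {c : K} (hc : c ∈ AA) {w : V} (hw : w ∈ M) : c • w ∈ M :=
  M.smul_mem ⟨c, hc⟩ hw

/-- The integral form generated by `v` under `intSubring F N`. -/
def intModule (F : ℤ → R) (v : V) (N : ℕ) : Submodule AA V where
  carrier := {w | ∃ u ∈ intSubring F N, w = u • v}
  add_mem' := by
    rintro _ _ ⟨u, hu, rfl⟩ ⟨u', hu', rfl⟩
    exact ⟨u + u', add_mem hu hu', (add_smul _ _ _).symm⟩
  zero_mem' := ⟨0, zero_mem _, (zero_smul _ _).symm⟩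
  smul_mem' := by
    rintro c _ ⟨u, hu, rfl⟩
    refine ⟨algebraMap K R c * u, mul_mem (algebraMap_mem_intSubring N c.2) hu, ?_⟩
    rw [mul_smul, algebraMap_smul]; rfl

variable {v : V}

theorem self_mem_intModule (N : ℕ) : v ∈ intModule F v N := ⟨1, one_mem _, (one_smul _ _).symm⟩

theorem smul_mem_intModule {N : ℕ} {u : R} (hu : u ∈ intSubring F N) {w : V}
    (hw : w ∈ intModule F v N) : u • w ∈ intModule F v N := by
  obtain ⟨u', hu', rfl⟩ := hw
  exact ⟨u * u', mul_mem hu hu', (mul_smul _ _ _).symm⟩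

theorem intModule_mono {N M : ℕ} (h : N ≤ M) : intModule F v N ≤ intModule F v M := by
  rintro _ ⟨u, hu, rfl⟩
  exact ⟨u, intSubring_mono h hu, rfl⟩

theorem smul_mem_of_mem_intSubring {M : Submodule AA V} {N : ℕ}
    (hM : ∀ (a : ℤ) (n : ℕ), -N ≤ a → a < N → ∀ w ∈ M, gdp 1 (F a) n • w ∈ M) {u : R}
    (hu : u ∈ intSubring F N) {w : V} (hw : w ∈ M) : u • w ∈ M := by
  induction hu using Subring.closure_induction generalizing w with
  | mem u hu =>
    rcases hu with ⟨c, hc, rfl⟩ | ⟨a, n, h1, h2, rfl⟩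
    · rw [algebraMap_smul]; exact AA_smul_mem hc hw
    · exact hM a n h1 h2 w hw
  | zero => rw [zero_smul]; exact zero_mem _
  | one => rwa [one_smul]
  | add _ _ _ _ h1 h2 => rw [add_smul]; exact add_mem (h1 hw) (h2 hw)
  | mul _ _ _ _ h1 h2 => rw [mul_smul]; exact h1 (h2 hw)
  | neg _ _ h1 => rw [neg_smul]; exact neg_mem (h1 hw)

theorem intModule_le {M : Submodule AA V} {N : ℕ}
    (hM : ∀ (a : ℤ) (n : ℕ), -N ≤ a → a < N → ∀ w ∈ M, gdp 1 (F a) n • w ∈ M) (hv : v ∈ M) :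
    intModule F v N ≤ M := by
  rintro _ ⟨u, hu, rfl⟩
  exact smul_mem_of_mem_intSubring hM hu hv

/-- The span of the monomials in the last `k` modified divided powers of the column `N`,
applied to `intModule F v N`. -/
def colModule (F : ℤ → R) (v : V) (N : ℕ) : ℕ → Submodule AA V
  | 0 => intModule F v N
  | k + 1 => Submodule.span AA
      {w | ∃ (n : ℕ), ∃ w' ∈ colModule F v N k, w = colPow F N (2 * N + 1 - k) n • w'}

theorem colPow_smul_mem {N k : ℕ} (n : ℕ) {w : V} (hw : w ∈ colModule F v N k) :
    colPow F N (2 * N + 1 - k) n • w ∈ colModule F v N (k + 1) :=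
  Submodule.subset_span ⟨n, w, hw, rfl⟩

theorem colModule_le_succ (N k : ℕ) : colModule F v N k ≤ colModule F v N (k + 1) := fun w hw => by
  simpa [colPow_zero] using colPow_smul_mem 0 hw

theorem colModule_mono (N : ℕ) : Monotone (colModule F v N) :=
  monotone_nat_of_le_succ (colModule_le_succ N)

namespace SerreFamily

variable (h : SerreFamily F)
include h

theorem colPow_smul_mem_of_lt {N k i : ℕ} (hk : k ≤ 2 * N + 2) (hi : 2 * N + 1 < i + k)
    (hi' : i ≤ 2 * N + 1) (m : ℕ) {w : V} (hw : w ∈ colModule F v N k) : colPow F N i m • w ∈ colModule F v N k := by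
  induction k generalizing w with
  | zero => omega
  | succ k ih =>
    refine smul_mem_of_mem_span ?_ hw
    rintro _ ⟨n, w', hw', rfl⟩
    rcases eq_or_ne (2 * N + 1 - k) i with rfl | hne
    · rw [← mul_smul, colPow, colPow, gdp_mul_gdp (by split_ifs <;> norm_num), smul_assoc]
      exact AA_smul_mem (gbinom_mem (by split_ifs <;> norm_num) _ _) (colPow_smul_mem _ hw')
    · rw [← mul_smul, colPow, colPow, gdp_mul_gdp_of_qcomm (h.col_mul_col (by omega)), smul_assoc,
        mul_smul]
      refine AA_smul_mem ?_ (colPow_smul_mem _ (ih (by omega) (by omega) hw'))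
      rw [← pow_mul]
      exact pow_mem (by simpa using q_zpow_mem (-1)) _

theorem colPow_smul_mem_top {N i : ℕ} (hi : i ≤ 2 * N + 1) (m : ℕ) {w : V}
    (hw : w ∈ colModule F v N (2 * N + 2)) : colPow F N i m • w ∈ colModule F v N (2 * N + 2) :=
  h.colPow_smul_mem_of_lt le_rfl (by omega) hi m hw

theorem gdp_col_smul_mem_top {N i : ℕ} (hi : i ≤ 2 * N + 1) (m : ℕ) {w : V}
    (hw : w ∈ colModule F v N (2 * N + 2)) :
    gdp 1 (col F N i) m • w ∈ colModule F v N (2 * N + 2) := by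
  have h1 := h.colPow_smul_mem_top hi m hw
  rw [colPow] at h1
  split_ifs at h1
  · rw [gdp_one_eq_smul_gdp_two, smul_assoc]
    exact AA_smul_mem (gfact_two_div_mem m) h1
  · exact h1

theorem gen_smul_mem_top {N i : ℕ} (hi : i ≤ 2 * N)
    (base : ∀ (n : ℕ), ∀ w ∈ intModule F v N,
      gdp 1 (F (N - i - 1)) n • w ∈ colModule F v N (2 * N + 2))
    {k : ℕ} (hk : k ≤ 2 * N + 2) (n : ℕ) {w : V} (hw : w ∈ colModule F v N k) :
    gdp 1 (F (N - i - 1)) n • w ∈ colModule F v N (2 * N + 2) := by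
  induction k generalizing n w with
  | zero => exact base n w hw
  | succ k ih =>
    refine smul_mem_of_mem_span ?_ hw
    rintro _ ⟨m, w', hw', rfl⟩
    rw [← mul_smul]
    have hj : 2 * N + 1 - k ≤ 2 * N + 1 := by omega
    generalize 2 * N + 1 - k = j at *
    rcases eq_or_ne i j with rfl | hij
    · rw [colPow_of_lt (by omega), (h.serrePair_col N i).gdp_mul_gdp, Finset.sum_smul]
      refine sum_mem fun p _ => ?_
      split_ifs
      · rw [smul_assoc, mul_smul, mul_smul]
        exact AA_smul_mem (q_zpow_mem _) (h.gdp_col_smul_mem_top (by omega) _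
          (h.gdp_col_smul_mem_top (by omega) _ (ih (by omega) _ hw')))
      · rw [zero_smul]; exact zero_mem _
    · rcases eq_or_ne (i + 1) j with rfl | hij'
      · rw [colPow, gdp_mul_gdp_of_qcomm (h.mul_col N i), smul_assoc, mul_smul, ← pow_mul]
        exact AA_smul_mem (pow_mem (by simpa using q_zpow_mem (-1)) _)
          (h.colPow_smul_mem_top hj _ (ih (by omega) _ hw'))
      · rw [colPow, (((h.commute_col hij hij').gdp_right _ _).gdp_left _ _).eq, mul_smul]
        exact h.colPow_smul_mem_top hj _ (ih (by omega) _ hw')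

theorem inner_smul_mem_top {N : ℕ} {u : R} (hu : u ∈ intSubring F N) {w : V}
    (hw : w ∈ colModule F v N (2 * N + 2)) : u • w ∈ colModule F v N (2 * N + 2) := by
  refine smul_mem_of_mem_intSubring (fun a n h1 h2 w hw => ?_) hu hw
  obtain ⟨i, hi⟩ : ∃ i : ℕ, (N : ℤ) - i - 1 = a := ⟨(N - 1 - a).toNat, by omega⟩
  rw [← hi]
  refine h.gen_smul_mem_top (by omega) (fun n w hw => ?_) le_rfl n hw
  exact colModule_mono N (Nat.zero_le _)
    (smul_mem_intModule (gdp_mem_intSubring (by omega) (by omega) n) hw)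

theorem straighten_zero (hv : ∀ a, F a • v = F (-1 - a) • v) (b : ℤ) (n : ℕ) :
    gdp 1 (F (-1)) n • v = ∑ i ∈ triples n,
      q ^ ((i.1 : ℤ) * (2 * b - i.2.1 - 2 * i.2.2) + (i.2.1.choose 2 : ℕ)) •
        mon3 0 (col F 0 0) (col F 0 1) i.1 i.2.1 i.2.2 • v := by
  have hp : SerrePair (F (-1)) (col F 0 0) (col F 0 1) := h.serrePair_col 0 0
  exact gdp_smul_straighten (d := fun _ => v) (Commute.zero_right _) hp (by simp) (by simp) hp.zy
    (fun c => by simpa [col, sgm_zero] using hv (-1)) b n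

theorem straighten_succ (hv : ∀ a, F a • v = F (-1 - a) • v) (N : ℕ) (b : ℤ) (n : ℕ) :
    gdp 1 (F (-1 - (N + 1 : ℕ))) n • gdpVec (col F N (2 * N + 1)) v b = ∑ i ∈ triples n,
      q ^ ((i.1 : ℤ) * (2 * b - i.2.1 - 2 * i.2.2) + (i.2.1.choose 2 : ℕ)) •
        mon3 (F (N + 1 : ℕ)) (col F (N + 1) (2 * (N + 1))) (col F (N + 1) (2 * (N + 1) + 1))
          i.1 i.2.1 i.2.2 • gdpVec (col F N (2 * N + 1)) v (b - i.2.1 - i.2.2) := by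
  have hxz := h.serrePair_col (N + 1) (2 * (N + 1))
  have e1 : ((N + 1 : ℕ) : ℤ) - (2 * (N + 1) : ℕ) - 1 = -1 - (N + 1 : ℕ) := by push_cast; ring
  rw [e1] at hxz
  have hxD := h.serrePair_head (-1 - (N + 1 : ℕ)) (2 * N + 1)
  have e2 : (-1 - (N + 1 : ℕ) : ℤ) + 1 = N - (2 * N + 1 : ℕ) := by push_cast; ring
  rw [e2] at hxD
  have hDy := h.serrePair_tail (N - (2 * N + 1 : ℕ)) (2 * N + 1)
  have e3 : (N : ℤ) - (2 * N + 1 : ℕ) + (2 * N + 1 : ℕ) + 1 = (N + 1 : ℕ) := by push_cast; ring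
  have e4 : (N : ℤ) - (2 * N + 1 : ℕ) = (N + 1 : ℕ) - (2 * (N + 1) : ℕ) := by push_cast; ring
  rw [e3] at hDy
  have hz : sgm F (N - (2 * N + 1 : ℕ)) (2 * N + 1 + 1) = col F (N + 1) (2 * (N + 1)) := by
    rw [e4]; rfl
  rw [hz] at hDy
  have h0 : col F (N + 1) 0 = F (N + 1 : ℕ) := by
    rw [col, Nat.cast_zero, sub_zero, sgm_zero]
  have hwv := h.sgm_smul_eq_mirror hv (N + 1) (2 * (N + 1)) (by omega) le_rfl
  rw [if_neg (by omega)] at hwv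
  refine gdp_smul_straighten (h.commute_of_lt (by push_cast; omega)) hxz ?_ ?_
    (h.col_mul_col (by omega)) (fun c => smul_gdpVec hxD hDy ?_ hwv c) b n
  · rw [← h0]; exact h.col_mul_col (by omega)
  · rw [← h0]; exact h.col_mul_col (by omega)
  · rw [hv]; congr 2; push_cast; ring

end SerreFamily

end Integral

section Integral

variable {R : Type*} [Ring R] [Algebra K R] {F : ℤ → R}
variable {V : Type*} [AddCommGroup V] [Module K V] [Module R V] [IsScalarTower K R V] {v : V}

theorem gdpVec_zero (D : R) (v : V) : gdpVec D v 0 = v := by simp [gdpVec, gdp_zero]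

theorem gdpVec_mem {M : Submodule AA V} {D : R} (hD : ∀ n, gdp 2 D n • v ∈ M) (c : ℤ) :
    gdpVec D v c ∈ M := by
  rw [gdpVec]
  split_ifs
  · exact zero_mem _
  · exact hD _

namespace SerreFamily

variable (h : SerreFamily F)
include h

theorem straighten (hv : ∀ a, F a • v = F (-1 - a) • v) (N : ℕ)
    (ih : ∀ k, N = k + 1 → ∀ n, gdp 2 (col F k (2 * k + 1)) n • v ∈ intModule F v N) :
    ∃ (y : R) (d : ℤ → V), (y = 0 ∨ y = F N) ∧ d 0 = v ∧ (∀ c, d c ∈ intModule F v N) ∧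
      (∀ k, N = k + 1 → d = gdpVec (col F k (2 * k + 1)) v) ∧
      ∀ (b : ℤ) (n : ℕ), gdp 1 (F (-1 - N)) n • d b = ∑ i ∈ triples n,
      q ^ ((i.1 : ℤ) * (2 * b - i.2.1 - 2 * i.2.2) + (i.2.1.choose 2 : ℕ)) •
        mon3 y (col F N (2 * N)) (col F N (2 * N + 1)) i.1 i.2.1 i.2.2 •
          d (b - i.2.1 - i.2.2) := by
  rcases N with _ | N
  · exact ⟨0, fun _ => v, Or.inl rfl, rfl, fun _ => self_mem_intModule 0, fun k hk => by omega,
      fun b n => by simpa using h.straighten_zero hv b n⟩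
  · refine ⟨F (N + 1 : ℕ), gdpVec (col F N (2 * N + 1)) v, Or.inr rfl, gdpVec_zero _ _,
      gdpVec_mem (ih N rfl), fun k hk => ?_, h.straighten_succ hv N⟩
    obtain rfl : N = k := by omega
    rfl

theorem gdp_zero_or_gen_mem {N M : ℕ} (hNM : N < M) {y : R} (hy : y = 0 ∨ y = F N) (n : ℕ) :
    gdp 1 y n ∈ intSubring F M := by
  rcases hy with rfl | rfl
  · rcases n with _ | n
    · rw [gdp_zero]; exact one_mem _
    · simp [gdp, zero_mem]
  · exact gdp_mem_intSubring (by omega) (by omega) n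

theorem commute_last {N : ℕ} {u : R} (hu : u ∈ intSubring F N) (n : ℕ) :
    Commute (gdp 2 (col F N (2 * N + 1)) n) u := by
  refine commute_of_mem_intSubring (fun a h1 h2 => ?_) hu
  exact (h.commute_sgm_of_mem (by push_cast; omega) (by push_cast; omega)).symm.gdp_left 2 n

theorem last_smul_mem (hv : ∀ a, F a • v = F (-1 - a) • v) (N : ℕ)
    (ih : ∀ k, N = k + 1 → ∀ n, gdp 2 (col F k (2 * k + 1)) n • v ∈ intModule F v N) (b : ℕ)
    {w : V} (hw : w ∈ intModule F v N) :
    gdp 2 (col F N (2 * N + 1)) b • w ∈ intModule F v (N + 1) := by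
  obtain ⟨y, d, hy, hd0, hd, -, hform⟩ := h.straighten hv N ih
  induction b using Nat.strong_induction_on generalizing w with
  | _ b ihb =>
    obtain ⟨u, hu, rfl⟩ := hw
    rw [← mul_smul, (h.commute_last hu b).eq, mul_smul]
    refine smul_mem_intModule (intSubring_mono (Nat.le_succ N) hu) ?_
    have h1 := hform b (2 * b)
    rw [← Finset.add_sum_erase _ _ (mem_triples.2 (by simp) : ((0, 0, b) : ℕ × ℕ × ℕ) ∈ _)] at h1
    simp only [Nat.cast_zero, zero_mul, Nat.choose_zero_succ, add_zero, zpow_zero, one_smul, mon3,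
      gdp_zero, one_mul, sub_zero, sub_self, hd0] at h1
    rw [← sub_eq_iff_eq_add] at h1
    rw [← h1]
    refine sub_mem (smul_mem_intModule (gdp_mem_intSubring (by push_cast; omega) (by push_cast; omega) _)
      (intModule_mono (Nat.le_succ N) (hd _))) (sum_mem ?_)
    rintro ⟨s, t, p⟩ hi
    obtain ⟨hi1, hi2⟩ := Finset.mem_erase.1 hi
    rw [mem_triples] at hi2
    have hp : p < b := by
      simp only [ne_eq, Prod.mk.injEq, not_and] at hi1 hi2
      omega
    rw [mul_smul, mul_smul]
    refine AA_smul_mem (q_zpow_mem _) (smul_mem_intModule (h.gdp_zero_or_gen_mem N.lt_succ_self hy _)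
      (smul_mem_intModule ?_ (ihb p hp (hd _))))
    exact h.gdp_sgm_mem (by push_cast; omega) (by push_cast; omega) _

theorem colModule_le_intModule (hv : ∀ a, F a • v = F (-1 - a) • v) (N : ℕ)
    (ih : ∀ k, N = k + 1 → ∀ n, gdp 2 (col F k (2 * k + 1)) n • v ∈ intModule F v N) {k : ℕ} :
    colModule F v N k ≤ intModule F v (N + 1) := by
  induction k with
  | zero => exact intModule_mono (Nat.le_succ N)
  | succ k ihk =>
    refine Submodule.span_le.2 ?_
    rintro _ ⟨n, w, hw, rfl⟩
    rcases k with _ | k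
    · rw [Nat.sub_zero, colPow_last]
      exact h.last_smul_mem hv N ih n hw
    · rw [colPow_of_lt (by omega)]
      exact smul_mem_intModule (h.gdp_sgm_mem (by push_cast; omega) (by push_cast; omega) _) (ihk hw)

theorem first_smul_mem (hv : ∀ a, F a • v = F (-1 - a) • v) (N : ℕ)
    (ih : ∀ k, N = k + 1 → intModule F v N = colModule F v k (2 * k + 2)) (n : ℕ) {w : V}
    (hw : w ∈ intModule F v N) : gdp 1 (F (-1 - N)) n • w ∈ colModule F v N (2 * N + 2) := by
  have ih' : ∀ k, N = k + 1 → ∀ n, gdp 2 (col F k (2 * k + 1)) n • v ∈ intModule F v N := by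
    intro k hk n
    rw [ih k hk, ← colPow_last]
    exact colModule_mono k (show 1 ≤ 2 * k + 2 by omega) (colPow_smul_mem n (self_mem_intModule k))
  obtain ⟨y, d, hy, hd0, hd, hd', hform⟩ := h.straighten hv N ih'
  have key : ∀ b, gdp 1 (F (-1 - N)) n • d b ∈ colModule F v N (2 * N + 2) := by
    intro b
    rw [hform]
    refine sum_mem ?_
    rintro ⟨s, t, p⟩ -
    rw [mon3, mul_smul, mul_smul, ← colPow_last, ← colPow_of_lt (by omega)]
    refine AA_smul_mem (q_zpow_mem _) ?_
    have h1 := h.colPow_smul_mem_top (i := 2 * N) (by omega) t (h.colPow_smul_mem_top le_rfl p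
      (colModule_mono N (Nat.zero_le _) (hd (b - t - p))))
    rcases hy with rfl | rfl
    · rcases s with _ | s
      · rwa [gdp_zero, one_smul]
      · simp [gdp, zero_mem]
    · have := h.colPow_smul_mem_top (i := 0) (by omega) s h1
      rwa [colPow_of_lt (by omega), col, Nat.cast_zero, sub_zero, sgm_zero] at this
  have key0 := key 0
  rw [hd0] at key0
  rcases N with _ | N
  · obtain ⟨u, hu, rfl⟩ := hw
    have hc : Commute (gdp 1 (F (-1 - (0 : ℕ))) n) u :=
      commute_of_mem_intSubring (fun a h1 h2 => by push_cast at h1 h2; omega) hu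
    rw [← mul_smul, hc.eq, mul_smul]
    exact h.inner_smul_mem_top hu key0
  · rw [ih N rfl] at hw
    have hc : ∀ u ∈ intSubring F N, Commute (gdp 1 (F (-1 - (N + 1 : ℕ))) n) u := fun u hu =>
      commute_of_mem_intSubring
        (fun a h1 h2 => (h.commute_of_lt (by push_cast; omega)).gdp_left 1 n) hu
    have main : ∀ k, ∀ w ∈ colModule F v N k,
        gdp 1 (F (-1 - (N + 1 : ℕ))) n • w ∈ colModule F v (N + 1) (2 * (N + 1) + 2) := by
      intro k
      induction k with
      | zero =>
        rintro _ ⟨u, hu, rfl⟩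
        rw [← mul_smul, (hc u hu).eq, mul_smul]
        exact h.inner_smul_mem_top (intSubring_mono (Nat.le_succ N) hu) key0
      | succ k ihk =>
        intro w hw
        refine smul_mem_of_mem_span ?_ hw
        rintro _ ⟨m, w, hw, rfl⟩
        rcases k with _ | k
        · obtain ⟨u, hu, rfl⟩ := hw
          have hm : gdp 2 (col F N (2 * N + 1)) m • v = d m := by
            rw [hd' N rfl, gdpVec, if_neg (by omega), Int.toNat_natCast]
          rw [Nat.sub_zero, colPow_last, ← mul_smul _ u, (h.commute_last hu m).eq, mul_smul, hm,
            ← mul_smul, (hc u hu).eq, mul_smul]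
          exact h.inner_smul_mem_top (intSubring_mono (Nat.le_succ N) hu) (key m)
        · rw [colPow_of_lt (by omega), ← mul_smul]
          have hcc : Commute (F (-1 - (N + 1 : ℕ))) (col F N (2 * N + 1 - (k + 1))) :=
            h.commute_sgm_of_far (by push_cast; omega)
          rw [((hcc.gdp_right 1 m).gdp_left 1 n).eq, mul_smul]
          exact h.inner_smul_mem_top
            (h.gdp_sgm_mem (by push_cast; omega) (by push_cast; omega) _) (ihk w hw)
    exact main _ w hw

/-- The integral module is spanned by ordered monomials in the column of segments ending at `N`,
applied to the previous integral module. -/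
theorem intModule_succ (hv : ∀ a, F a • v = F (-1 - a) • v) (N : ℕ) :
    intModule F v (N + 1) = colModule F v N (2 * N + 2) := by
  induction N using Nat.strong_induction_on with
  | _ N ih =>
    have ih1 : ∀ k, N = k + 1 → intModule F v N = colModule F v k (2 * k + 2) := by
      rintro k rfl
      exact ih k k.lt_succ_self
    have ih2 : ∀ k, N = k + 1 → ∀ n, gdp 2 (col F k (2 * k + 1)) n • v ∈ intModule F v N := by
      intro k hk n
      rw [ih1 k hk, ← colPow_last]
      exact colModule_mono k (show 1 ≤ 2 * k + 2 by omega) (colPow_smul_mem n (self_mem_intModule k))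
    refine le_antisymm (intModule_le (fun a n h1 h2 w hw => ?_)
      (colModule_mono N (Nat.zero_le _) (self_mem_intModule N))) (h.colModule_le_intModule hv N ih2)
    push_cast at h1 h2
    rcases eq_or_ne a N with rfl | h3
    · have := h.colPow_smul_mem_top (i := 0) (by omega) n hw
      rwa [colPow_of_lt (by omega), col, Nat.cast_zero, sub_zero, sgm_zero] at this
    rcases eq_or_ne a (-1 - N) with rfl | h4
    · have e : (N : ℤ) - (2 * N : ℕ) - 1 = -1 - N := by push_cast; ring
      rw [← e]
      refine h.gen_smul_mem_top le_rfl (fun n w hw => ?_) le_rfl n hw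
      rw [e]
      exact h.first_smul_mem hv N ih1 n hw
    · exact h.inner_smul_mem_top (gdp_mem_intSubring (by omega) (by omega) n) hw

end SerreFamily

end Integral

/-! ### Twisted derivations -/

/-- The Cartan matrix of `gl_∞`. -/
def cartan (a b : ℤ) : ℤ := if a = b then 2 else if a = b + 1 ∨ b = a + 1 then -1 else 0

/-- The pairing of the simple root `a` with the weight of the segment `⟨c, c + n⟩`. -/
def segWeight (a c : ℤ) : ℕ → ℤ
  | 0 => cartan a c
  | n + 1 => segWeight a c n + cartan a (c + n + 1)

theorem segWeight_eq (a c : ℤ) (n : ℕ) : segWeight a c n =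
    (if a = c then 1 else 0) + (if a = c + n then 1 else 0) - (if a = c - 1 then 1 else 0)
      - (if a = c + n + 1 then 1 else 0) := by
  induction n with
  | zero => simp only [segWeight, cartan]; split_ifs <;> omega
  | succ n ih =>
    simp only [segWeight, cartan, ih]
    push_cast
    split_ifs <;> omega

theorem segWeight_succ' (a c : ℤ) (n : ℕ) :
    segWeight a c (n + 1) = cartan a c + segWeight a (c + 1) n := by
  simp only [segWeight_eq, cartan]
  push_cast
  split_ifs <;> omega

section Derivations

variable {R : Type*} [Ring R] [Algebra K R]

/-- The relations satisfied by the operators `E a` and `T a` adjoint to the generators `F a` on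
`Ṽ_θ(0)`. -/
structure TwistedDerivation (F E T : ℤ → R) : Prop where
  ef : ∀ a b, E a * F b = q ^ (-cartan a b) • (F b * E a) + (if a = b then 1 else 0)
    + (if -1 - a = b then T a else 0)
  tf : ∀ a b, T a * F b = q ^ (-(cartan a b + cartan (-1 - a) b)) • (F b * T a)

variable {F E T : ℤ → R}

theorem q_zpow_add (m n : ℤ) : q ^ (m + n) = q ^ m * q ^ n := zpow_add₀ q_ne_zero m n

namespace TwistedDerivation

variable (hE : TwistedDerivation F E T)
include hE

theorem ef_of_ne {a b : ℤ} (h1 : a ≠ b) (h2 : -1 - a ≠ b) :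
    E a * F b = q ^ (-cartan a b) • (F b * E a) := by
  rw [hE.ef, if_neg h1, if_neg h2, add_zero, add_zero]

theorem ef_self (a : ℤ) : E a * F a = q ^ (-2 : ℤ) • (F a * E a) + 1 := by
  rw [hE.ef, if_pos rfl, if_neg (by omega), add_zero, cartan, if_pos rfl]

theorem ef_mirror (a : ℤ) :
    E a * F (-1 - a) = q ^ (-cartan a (-1 - a)) • (F (-1 - a) * E a) + T a := by
  rw [hE.ef, if_neg (by omega), if_pos rfl, add_zero]

theorem t_sgm (a c : ℤ) (n : ℕ) : T a * sgm F c n =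
    q ^ (-(segWeight a c n + segWeight (-1 - a) c n)) • (sgm F c n * T a) := by
  induction n with
  | zero => exact hE.tf a c
  | succ n ih =>
    have h1 := hE.tf a (c + n + 1)
    have e : q ^ (-(segWeight a c (n + 1) + segWeight (-1 - a) c (n + 1))) =
        q ^ (-(segWeight a c n + segWeight (-1 - a) c n)) *
          q ^ (-(cartan a (c + n + 1) + cartan (-1 - a) (c + n + 1))) := by
      rw [← q_zpow_add, segWeight, segWeight]; congr 1; ring
    rw [sgm_succ, e]
    generalize q ^ (-(segWeight a c n + segWeight (-1 - a) c n)) = r at *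
    generalize q ^ (-(cartan a (c + n + 1) + cartan (-1 - a) (c + n + 1))) = t at *
    generalize sgm F c n = s at *
    generalize F (c + n + 1) = f at *
    linear_combination (norm := (simp only [mul_add, add_mul, mul_sub, sub_mul, smul_mul_assoc,
      mul_smul_comm, mul_assoc]; module)) ih * f + r • (s * h1) - q • (h1 * s) - (q * t) • (f * ih)

variable (h : SerreFamily F)
include h

theorem e_sgm_aux (n : ℕ) : ∀ a c : ℤ, -1 - a ≠ c + n →
    (a ≠ c → E a * sgm F c n = q ^ (-segWeight a c n) • (sgm F c n * E a)) ∧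
    (a = c → ∀ m, n = m + 1 → E a * sgm F c n =
      q⁻¹ • (sgm F c n * E a) + (1 - q ^ 2) • sgm F (c + 1) m) := by
  induction n with
  | zero =>
    intro a c h1
    exact ⟨fun h2 => hE.ef_of_ne h2 (by simpa using h1), fun _ m hm => by omega⟩
  | succ n ih =>
    intro a c h1
    push_cast at h1
    refine ⟨fun h2 => ?_, ?_⟩
    · by_cases h3 : -1 - a = c + n
      · have hW := segWeight_succ' a c n
        rw [h.sgm_succ', hW, neg_add, q_zpow_add]
        by_cases h4 : a = c + 1
        · rcases n with _ | n
          · have e1 := hE.ef_self a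
            have e2 := hE.ef_mirror a
            have e3 := hE.tf a a
            have hc : c = -1 - a := by simpa using h3.symm
            have ha : a = 0 := by omega
            subst hc
            subst ha
            have e0 : segWeight 0 (-1 - 0 + 1) 0 = 2 := by decide
            have e4 : cartan 0 (-1 - 0) = -1 := by decide
            have e5 : cartan 0 0 + cartan (-1 - 0) 0 = 1 := by decide
            rw [e4] at e2 ⊢
            rw [e5] at e3
            rw [e0]
            have e6 : (-1 - 0 + 1 : ℤ) = 0 := by norm_num
            rw [e6, sgm_zero]
            have e7 : q ^ (-(-1) : ℤ) = q := by simp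
            have e9 : q ^ (-2 : ℤ) = q⁻¹ * q⁻¹ := by
              rw [← zpow_neg_one, ← q_zpow_add]; norm_num
            have e8 : q ^ (-1 : ℤ) = q * (q⁻¹ * q⁻¹) := by
              rw [mul_inv_cancel_left₀ q_ne_zero, zpow_neg_one]
            rw [e7] at e2 ⊢
            rw [e8] at e3
            rw [e9] at e1 ⊢
            generalize F (-1 - 0) = f at *
            generalize F 0 = g at *
            generalize E 0 = e at *
            generalize T 0 = t at *
            linear_combination (norm := (simp only [mul_add, add_mul, mul_sub, sub_mul,
              smul_mul_assoc, mul_smul_comm, mul_assoc, mul_one, one_mul]; module))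
              e2 * g + q • (f * e1) + e3 - q • (e1 * f) - (q * (q⁻¹ * q⁻¹)) • (g * e2)
          · subst h4
            have e1 := (ih (c + 1) (c + 1) (by push_cast; omega)).2 rfl n rfl
            have e2 := hE.ef_of_ne (a := c + 1) (b := c) (by omega) (by omega)
            have e3 : cartan (c + 1) c = -1 := by simp [cartan]
            have e4 : segWeight (c + 1) (c + 1) (n + 1) = 1 := by
              rw [segWeight_eq]; push_cast; split_ifs <;> omega
            have e5 : F c * sgm F (c + 1 + 1) n = sgm F (c + 1 + 1) n * F c :=
              (h.commute_sgm_of_far (by omega)).eq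
            rw [e3] at e2 ⊢
            have e7 : q ^ (-(-1) : ℤ) = q := by simp
            rw [e7] at e2 ⊢
            rw [e4, zpow_neg_one]
            generalize F c = f at *
            generalize sgm F (c + 1 + 1) n = t at *
            generalize sgm F (c + 1) (n + 1) = s at *
            generalize E (c + 1) = e at *
            linear_combination (norm := (simp only [mul_add, add_mul, mul_sub, sub_mul,
              smul_mul_assoc, mul_smul_comm, mul_assoc]; module))
              e2 * s + q • (f * e1) - q • (e1 * f) - (q * q⁻¹) • (s * e2)
                + (q * (1 - q ^ 2)) • e5
        · have e1 := (ih a (c + 1) (by omega)).1 h4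
          have e2 := hE.ef a c
          rw [if_neg h2, add_zero] at e2
          generalize q ^ (-cartan a c) = r at *
          by_cases h5 : -1 - a = c
          · rw [if_pos h5] at e2
            have e3 := hE.t_sgm a (c + 1) n
            have e4 : segWeight (-1 - a) (c + 1) n = -1 := by
              rw [segWeight_eq]; split_ifs <;> omega
            rw [e4, neg_add, neg_neg, q_zpow_add, zpow_one] at e3
            generalize q ^ (-segWeight a (c + 1) n) = u at *
            generalize sgm F (c + 1) n = s at *
            generalize F c = f at *
            generalize E a = e at *
            generalize T a = t at *
            linear_combination (norm := (simp only [mul_add, add_mul, mul_sub, sub_mul,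
              smul_mul_assoc, mul_smul_comm, mul_assoc]; module))
              e2 * s + r • (f * e1) + e3 - q • (e1 * f) - (q * u) • (s * e2)
          · rw [if_neg h5, add_zero] at e2
            generalize q ^ (-segWeight a (c + 1) n) = u at *
            generalize sgm F (c + 1) n = s at *
            generalize F c = f at *
            generalize E a = e at *
            linear_combination (norm := (simp only [mul_add, add_mul, mul_sub, sub_mul,
              smul_mul_assoc, mul_smul_comm, mul_assoc]; module))
              e2 * s + r • (f * e1) - q • (e1 * f) - (q * u) • (s * e2)
      · have e1 := (ih a c h3).1 h2
        have e2 := hE.ef a (c + n + 1)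
        rw [if_neg (by omega : ¬ -1 - a = c + n + 1), add_zero] at e2
        have e3 : (if a = c + n + 1 then 1 else 0 : R) = (if a = c + n + 1 then 1 else 0 : K) • 1 := by
          split_ifs <;> simp
        have e4 : (if a = c + n + 1 then 1 else 0 : K) * (q ^ (-segWeight a c n) - q) = 0 := by
          split_ifs with h5
          · have : segWeight a c n = -1 := by rw [segWeight_eq]; split_ifs <;> omega
            simp [this]
          · simp
        rw [e3] at e2
        rw [sgm_succ, segWeight, neg_add, q_zpow_add]
        generalize (if a = c + n + 1 then 1 else 0 : K) = δ at *
        generalize q ^ (-segWeight a c n) = u at *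
        generalize q ^ (-cartan a (c + n + 1)) = r at *
        generalize sgm F c n = s at *
        have e5 : (δ * (u - q)) • s = 0 := by rw [e4, zero_smul]
        generalize F (c + n + 1) = f at *
        generalize E a = e at *
        linear_combination (norm := (simp only [mul_add, add_mul, mul_sub, sub_mul,
          smul_mul_assoc, mul_smul_comm, mul_assoc, mul_one, one_mul]; module))
          e1 * f + u • (s * e2) - q • (e2 * s) - (q * r) • (f * e1) + e5
    · rintro rfl m hm
      obtain rfl : n = m := by omega
      have e1 := (ih a (a + 1) (by omega)).1 (by omega)
      have e4 : segWeight a (a + 1) n = -1 := by rw [segWeight_eq]; split_ifs <;> omega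
      rw [e4, neg_neg, zpow_one] at e1
      have e2 := hE.ef_self a
      have e5 : q ^ (-2 : ℤ) = q⁻¹ * q⁻¹ := by
        rw [← zpow_neg_one, ← q_zpow_add]; norm_num
      rw [e5] at e2
      have e6 : q⁻¹ = q * (q⁻¹ * q⁻¹) := by rw [mul_inv_cancel_left₀ q_ne_zero]
      rw [h.sgm_succ', e6]
      generalize q⁻¹ * q⁻¹ = r at *
      generalize F a = f at *
      generalize sgm F (a + 1) n = s at *
      generalize E a = e at *
      linear_combination (norm := (simp only [mul_add, add_mul, mul_sub, sub_mul,
        smul_mul_assoc, mul_smul_comm, mul_assoc, mul_one, one_mul]; module))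
        e2 * s + r • (f * e1) - q • (e1 * f) - (q * q) • (s * e2)

theorem e_sgm_of_ne {a c : ℤ} {n : ℕ} (h1 : -1 - a ≠ c + n) (h2 : a ≠ c) :
    E a * sgm F c n = q ^ (-segWeight a c n) • (sgm F c n * E a) :=
  (hE.e_sgm_aux h n a c h1).1 h2

theorem e_sgm_head {a : ℤ} {n : ℕ} (h1 : -1 - a ≠ a + n + 1) :
    E a * sgm F a (n + 1) = q⁻¹ • (sgm F a (n + 1) * E a) + (1 - q ^ 2) • sgm F (a + 1) n :=
  (hE.e_sgm_aux h (n + 1) a a (by push_cast; omega)).2 rfl n rfl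

end TwistedDerivation
end Derivations

section Columns

variable {R : Type*} [Ring R] [Algebra K R]
variable {V : Type*} [AddCommGroup V] [Module K V] [Module R V] [IsScalarTower K R V]

/-- Membership in the `K`-span of the vectors obtained from `B` by applying products of elements of
`S`. -/
inductive OpGen (S : Set R) (B : Set V) : V → Prop
  | base {w : V} (hw : w ∈ B) : OpGen S B w
  | act {x : R} {w : V} (hx : x ∈ S) (hw : OpGen S B w) : OpGen S B (x • w)
  | zero : OpGen S B 0
  | add {w w' : V} (hw : OpGen S B w) (hw' : OpGen S B w') : OpGen S B (w + w')
  | smul (c : K) {w : V} (hw : OpGen S B w) : OpGen S B (c • w)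

theorem OpGen.mono {S S' : Set R} {B B' : Set V} (hS : S ⊆ S') (hB : B ⊆ B') {w : V}
    (hw : OpGen S B w) : OpGen S' B' w := by
  induction hw with
  | base h => exact .base (hB h)
  | act hx _ ih => exact .act (hS hx) ih
  | zero => exact .zero
  | add _ _ h1 h2 => exact .add h1 h2
  | smul c _ h1 => exact .smul c h1

theorem OpGen.pow_smul {S : Set R} {B : Set V} {x : R} (hx : x ∈ S) (n : ℕ) {w : V}
    (hw : OpGen S B w) : OpGen S B (x ^ n • w) := by
  induction n with
  | zero => simpa using hw
  | succ n ih => rw [pow_succ', mul_smul]; exact .act hx ih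

/-- The `K`-span of the vectors generated from `v` by `F a` for `-N ≤ a < N`. -/
def InnerGen (F : ℤ → R) (v : V) (N : ℕ) : V → Prop :=
  OpGen {x | ∃ a : ℤ, -N ≤ a ∧ a < N ∧ x = F a} {v}

/-- The `K`-span of the vectors generated from `InnerGen F v N` by the segments `col F N j` for
`k ≤ j ≤ 2 * N + 1`. -/
def OuterGen (F : ℤ → R) (v : V) (N k : ℕ) : V → Prop :=
  OpGen {x | ∃ j, k ≤ j ∧ j ≤ 2 * N + 1 ∧ x = col F N j} {w | InnerGen F v N w}

/-- The product of the operators adjoint to `F N, …, F (N - j)`. -/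
def colAdj (E : ℤ → R) (N : ℕ) : ℕ → R
  | 0 => E N
  | j + 1 => colAdj E N j * E (N - (j + 1 : ℕ))

/-- The vacuum relations for the operators adjoint to the generators. -/
structure IsVacuum (F E T : ℤ → R) (v : V) : Prop where
  mirror : ∀ a, F a • v = F (-1 - a) • v
  e_smul : ∀ a, E a • v = 0
  t_smul : ∀ a, T a • v = v

variable {F E T : ℤ → R} {v : V}

theorem OuterGen.mono {N k l : ℕ} (h : k ≤ l) {w : V} (hw : OuterGen F v N l w) : OuterGen F v N k w := by
  unfold OuterGen at hw ⊢
  refine hw.mono ?_ subset_rfl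
  rintro _ ⟨j, h1, h2, rfl⟩
  exact ⟨j, h.trans h1, h2, rfl⟩

theorem OuterGen.pow_smul {N k j : ℕ} (h1 : k ≤ j) (h2 : j ≤ 2 * N + 1) (n : ℕ) {w : V}
    (hw : OuterGen F v N k w) : OuterGen F v N k (col F N j ^ n • w) := by
  unfold OuterGen at hw ⊢
  refine OpGen.pow_smul ?_ n hw
  exact ⟨j, h1, h2, rfl⟩

theorem OuterGen.inner {N k : ℕ} (hk : 2 * N + 1 < k) {w : V} (hw : OuterGen F v N k w) :
    InnerGen F v N w := by
  induction hw with
  | base h => exact h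
  | act hx _ ih => obtain ⟨j, h1, h2, -⟩ := hx; omega
  | zero => exact .zero
  | add _ _ h1 h2 => exact .add h1 h2
  | smul c _ h1 => exact .smul c h1

theorem InnerGen.sgm_smul {N : ℕ} {a : ℤ} {n : ℕ} (h1 : -N ≤ a) (h2 : a + n < N) {w : V}
    (hw : InnerGen F v N w) : InnerGen F v N (sgm F a n • w) := by
  induction n generalizing w with
  | zero => exact .act ⟨a, h1, by simpa using h2, rfl⟩ hw
  | succ n ih =>
    push_cast at h2
    have hm : ∀ {w : V}, InnerGen F v N w → InnerGen F v N (F (a + n + 1) • w) :=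
      fun hw => .act ⟨_, by omega, by omega, rfl⟩ hw
    rw [sgm_succ, sub_smul, smul_assoc, mul_smul, mul_smul, sub_eq_add_neg, ← neg_smul]
    exact .add (ih (by omega) (hm hw)) (.smul _ (hm (ih (by omega) hw)))

theorem OuterGen.inner_succ {N : ℕ} {w : V} (hw : OuterGen F v N 0 w) : InnerGen F v (N + 1) w := by
  induction hw with
  | base h =>
    have h : InnerGen F v N _ := h
    unfold InnerGen at h ⊢
    refine h.mono ?_ subset_rfl
    rintro _ ⟨a, h1, h2, rfl⟩
    exact ⟨a, by push_cast; omega, by push_cast; omega, rfl⟩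
  | act hx _ ih =>
    obtain ⟨j, -, h2, rfl⟩ := hx
    exact InnerGen.sgm_smul (by push_cast; omega) (by push_cast; omega) ih
  | zero => exact .zero
  | add _ _ h1 h2 => exact .add h1 h2
  | smul c _ h1 => exact .smul c h1

namespace TwistedDerivation

variable (hE : TwistedDerivation F E T) (h : SerreFamily F) (hv : IsVacuum F E T v)

include hE

theorem e_f_smul (a b : ℤ) (w : V) : E a • F b • w = q ^ (-cartan a b) • F b • E a • w +
    (if a = b then w else 0) + (if -1 - a = b then T a • w else 0) := by
  rw [← mul_smul, hE.ef, add_smul, add_smul, smul_assoc, mul_smul]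
  congr 1
  · congr 1; split_ifs <;> simp
  · split_ifs <;> simp

section Vacuum

include hv

theorem t_inner {N : ℕ} {w : V} (hw : InnerGen F v N w) (a : ℤ) : InnerGen F v N (T a • w) := by
  induction hw with
  | base h =>
    rw [Set.mem_singleton_iff.1 h, hv.t_smul]; exact .base rfl
  | act hx _ ih =>
    obtain ⟨b, h1, h2, rfl⟩ := hx
    rw [← mul_smul, hE.tf, smul_assoc, mul_smul]
    exact .smul _ (.act ⟨b, h1, h2, rfl⟩ ih)
  | zero => rw [smul_zero]; exact .zero
  | add _ _ h1 h2 => rw [smul_add]; exact .add h1 h2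
  | smul c _ h1 => rw [smul_comm]; exact .smul c h1

theorem e_inner {N : ℕ} {w : V} (hw : InnerGen F v N w) (a : ℤ) : InnerGen F v N (E a • w) := by
  induction hw with
  | base h => rw [Set.mem_singleton_iff.1 h, hv.e_smul]; exact .zero
  | act hx hw ih =>
    obtain ⟨b, h1, h2, rfl⟩ := hx
    rw [hE.e_f_smul]
    refine .add (.add (.smul _ (.act ⟨b, h1, h2, rfl⟩ ih)) ?_) ?_
    · split_ifs
      exacts [hw, .zero]
    · split_ifs
      exacts [hE.t_inner hv hw a, .zero]
  | zero => rw [smul_zero]; exact .zero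
  | add _ _ h1 h2 => rw [smul_add]; exact .add h1 h2
  | smul c _ h1 => rw [smul_comm]; exact .smul c h1

theorem e_inner_eq_zero {N : ℕ} {w : V} (hw : InnerGen F v N w) {a : ℤ} (ha : a < -N ∨ N ≤ a) :
    E a • w = 0 := by
  induction hw with
  | base h => rw [Set.mem_singleton_iff.1 h, hv.e_smul]
  | act hx hw ih =>
    obtain ⟨b, h1, h2, rfl⟩ := hx
    rw [hE.e_f_smul, ih, if_neg (by omega), if_neg (by omega)]; simp
  | zero => rw [smul_zero]
  | add _ _ h1 h2 => rw [smul_add, h1, h2, add_zero]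
  | smul c _ h1 => rw [smul_comm, h1, smul_zero]

end Vacuum

include h

theorem e_col_of_ne {N i j : ℕ} (hij : i ≠ j) (hi : i ≤ 2 * N) :
    E (N - i) * col F N j = q ^ (-segWeight (N - i) (N - j) j) • (col F N j * E (N - i)) :=
  hE.e_sgm_of_ne h (by omega) (by omega)

theorem e_col_succ {N j : ℕ} (hj : j + 1 ≤ 2 * N) :
    E (N - (j + 1 : ℕ)) * col F N (j + 1) = q⁻¹ • (col F N (j + 1) * E (N - (j + 1 : ℕ)))
      + (1 - q ^ 2) • col F N j := by
  have := hE.e_sgm_head h (a := N - (j + 1 : ℕ)) (n := j) (by push_cast; omega)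
  rw [col, this, col]
  congr 3
  push_cast; ring

include hv

theorem e_outer_of_lt {N i k : ℕ} (hik : i < k) (hi : i ≤ 2 * N) {w : V} (hw : OuterGen F v N k w) :
    OuterGen F v N k (E (N - i) • w) := by
  induction hw with
  | base h => exact .base (hE.e_inner hv h _)
  | act hx hw ih =>
    obtain ⟨j, h1, h2, rfl⟩ := hx
    rw [← mul_smul, hE.e_col_of_ne h (by omega) hi, smul_assoc, mul_smul]
    exact .smul _ (.act ⟨j, h1, h2, rfl⟩ ih)
  | zero => rw [smul_zero]; exact .zero
  | add _ _ h1 h2 => rw [smul_add]; exact .add h1 h2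
  | smul c _ h1 => rw [smul_comm]; exact .smul c h1

theorem e_zero_outer {N k : ℕ} (hk : 0 < k) {w : V} (hw : OuterGen F v N k w) : E N • w = 0 := by
  induction hw with
  | base h => exact hE.e_inner_eq_zero hv h (Or.inr le_rfl)
  | act hx hw ih =>
    obtain ⟨j, h1, h2, rfl⟩ := hx
    have := hE.e_col_of_ne h (N := N) (i := 0) (j := j) (by omega) (by omega)
    rw [Nat.cast_zero, sub_zero] at this
    rw [← mul_smul, this, smul_assoc, mul_smul, ih, smul_zero, smul_zero]
  | zero => rw [smul_zero]
  | add _ _ h1 h2 => rw [smul_add, h1, h2, add_zero]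
  | smul c _ h1 => rw [smul_comm, h1, smul_zero]

theorem colAdj_outer {N j k : ℕ} (hjk : j < k) (hj : j ≤ 2 * N + 1) {w : V}
    (hw : OuterGen F v N k w) : colAdj E N j • w = 0 := by
  induction j generalizing w with
  | zero => exact hE.e_zero_outer h hv hjk hw
  | succ j ih =>
    rw [colAdj, mul_smul]
    by_cases hj' : j + 1 ≤ 2 * N
    · exact ih (by omega) (by omega) (hE.e_outer_of_lt h hv hjk hj' hw)
    · rw [hE.e_inner_eq_zero hv (hw.inner (by omega)) (by push_cast; omega), smul_zero]

end TwistedDerivation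

end Columns

/-- The geometric sum `1 + q⁻² + ⋯ + q^{-2(n - 1)}`. -/
def qgeom (n : ℕ) : K := ∑ i ∈ Finset.range n, (q⁻¹ ^ 2) ^ i

theorem qgeom_succ (n : ℕ) : qgeom (n + 1) = q⁻¹ ^ 2 * qgeom n + 1 := geom_sum_succ

theorem qgeom_succ' (n : ℕ) : qgeom (n + 1) = qgeom n + (q⁻¹ ^ 2) ^ n := Finset.sum_range_succ _ _

theorem qgeom_ne_zero {n : ℕ} (hn : n ≠ 0) : qgeom n ≠ 0 := fun h => by
  have h1 := geom_sum_mul (q⁻¹ ^ 2) n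
  rw [← qgeom, h, zero_mul, ← pow_mul, inv_pow] at h1
  exact q_pow_ne_one (n := 2 * n) (by omega) (inv_eq_one.1 (sub_eq_zero.1 h1.symm))

section Columns

variable {R : Type*} [Ring R] [Algebra K R]

theorem mul_pow_of_qderiv {e x y : R} {c s t : K} (hex : e * x = t • (x * e) + c • y)
    (hxy : x * y = s • (y * x)) (hst : t * s = q⁻¹ ^ 2) (n : ℕ) :
    e * x ^ (n + 1) = t ^ (n + 1) • (x ^ (n + 1) * e) + (c * qgeom (n + 1)) • (y * x ^ n) := by
  induction n with
  | zero => simp [qgeom, hex]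
  | succ n ih =>
    have h1 : x * (y * x ^ n) = s • (y * (x * x ^ n)) := by
      rw [← mul_assoc, hxy, smul_mul_assoc, mul_assoc]
    rw [pow_succ' x (n + 1), ← mul_assoc, hex, qgeom_succ (n + 1), ← hst, pow_succ' t (n + 1)]
    rw [pow_succ' x n] at ih ⊢
    linear_combination (norm := (simp only [mul_add, add_mul, mul_sub, sub_mul, smul_mul_assoc,
      mul_smul_comm, mul_assoc]; module)) t • (x * ih) + (t * (c * qgeom (n + 1))) • h1

variable {V : Type*} [AddCommGroup V] [Module K V] [Module R V] [IsScalarTower K R V]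
variable {F E T : ℤ → R} {v : V}

namespace TwistedDerivation

variable (hE : TwistedDerivation F E T) (h : SerreFamily F)

include hE h

theorem e_col_pow_zero (N n : ℕ) : E N * col F N 0 ^ (n + 1) =
    (q⁻¹ ^ 2) ^ (n + 1) • (col F N 0 ^ (n + 1) * E N) + qgeom (n + 1) • col F N 0 ^ n := by
  have h1 : E N * col F N 0 = q⁻¹ ^ 2 • (col F N 0 * E N) + (1 : K) • 1 := by
    have := hE.ef_self N
    rw [col, Nat.cast_zero, sub_zero, sgm_zero, this, one_smul, inv_pow, zpow_neg]
    norm_cast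
  simpa using mul_pow_of_qderiv h1 (s := 1) (by simp) (by simp) n

theorem e_col_pow_succ {N j : ℕ} (hj : j + 1 ≤ 2 * N) (n : ℕ) :
    E (N - (j + 1 : ℕ)) * col F N (j + 1) ^ (n + 1) =
      q⁻¹ ^ (n + 1) • (col F N (j + 1) ^ (n + 1) * E (N - (j + 1 : ℕ)))
        + ((1 - q ^ 2) * qgeom (n + 1)) • (col F N j * col F N (j + 1) ^ n) :=
  mul_pow_of_qderiv (hE.e_col_succ h hj) (h.col_mul_col j.lt_succ_self) (by ring) n

variable (hv : IsVacuum F E T v)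
include hv

theorem colAdj_col_pow {N j : ℕ} (hj : j ≤ 2 * N) (n : ℕ) : ∃ γ : K, γ ≠ 0 ∧
    ∀ w, OuterGen F v N (j + 1) w →
      colAdj E N j • col F N j ^ (n + 1) • w = γ • col F N j ^ n • w := by
  induction j generalizing n with
  | zero =>
    refine ⟨_, qgeom_ne_zero n.succ_ne_zero, fun w hw => ?_⟩
    rw [colAdj, ← mul_smul, hE.e_col_pow_zero h, add_smul, smul_assoc, smul_assoc, mul_smul,
      hE.e_zero_outer h hv one_pos hw, smul_zero, smul_zero, zero_add]
  | succ j ih =>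
    obtain ⟨γ, hγ, H⟩ := ih (by omega) 0
    have hc := mul_ne_zero one_sub_q_sq_ne_zero (qgeom_ne_zero n.succ_ne_zero)
    have hcol := hE.e_col_pow_succ h hj n
    generalize (1 - q ^ 2) * qgeom (n + 1) = c at hc hcol
    refine ⟨c * γ, mul_ne_zero hc hγ, fun w hw => ?_⟩
    have h1 : OuterGen F v N (j + 1) (col F N (j + 1) ^ n • w) :=
      (hw.mono (by omega)).pow_smul le_rfl (by omega) n
    have h2 : OuterGen F v N (j + 1) (col F N (j + 1) ^ (n + 1) • E (N - (j + 1 : ℕ)) • w) :=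
      ((hE.e_outer_of_lt h hv (by omega) hj hw).mono (by omega)).pow_smul le_rfl (by omega) _
    have H := H _ h1
    simp only [zero_add, pow_one, pow_zero, one_smul] at H
    rw [colAdj, mul_smul, ← mul_smul (E _), hcol, add_smul, smul_assoc, smul_assoc,
      mul_smul, mul_smul, smul_add, smul_comm (colAdj E N j) (_ : K),
      hE.colAdj_outer h hv j.lt_succ_self (by omega) h2, smul_zero, zero_add,
      smul_comm (colAdj E N j) (_ : K), H, smul_smul]

theorem e_col_last (N : ℕ) : ∃ Y : R,
    E (-1 - N) * col F N (2 * N + 1) = q⁻¹ • (col F N (2 * N + 1) * E (-1 - N))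
      + (1 - q ^ 2) • col F N (2 * N) + Y * T (-1 - N) ∧
    Y * col F N (2 * N + 1) = q⁻¹ • (col F N (2 * N + 1) * Y) ∧
    ∀ w, InnerGen F v N w → Y • T (-1 - N) • w =
      ((1 - q ^ 2) * q⁻¹ ^ 2) • col F N (2 * N) • w := by
  rcases N with _ | N
  · have e1 := hE.ef_self (-1)
    have e2 := hE.ef_mirror (-1)
    have e3 := hE.tf (-1) (-1)
    have e5 : q ^ (-2 : ℤ) = q⁻¹ * q⁻¹ := by
      rw [← zpow_neg_one, ← q_zpow_add]; norm_num
    rw [e5] at e1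
    have e6 : (-1 - -1 : ℤ) = 0 := by norm_num
    have e7 : cartan (-1) 0 = -1 := by decide
    have e8 : cartan (-1) (-1) + cartan 0 (-1) = 1 := by decide
    rw [e6, e7, neg_neg, zpow_one] at e2
    rw [e6, e8] at e3
    have e9 : q ^ (-1 : ℤ) = q⁻¹ := by simp
    have e10 : q⁻¹ = q * (q⁻¹ * q⁻¹) := by rw [mul_inv_cancel_left₀ q_ne_zero]
    have e11 : col F 0 (2 * 0 + 1) = F (-1) * F 0 - q • (F 0 * F (-1)) := by simp [col, sgm]
    have e12 : col F 0 (2 * 0) = F 0 := by simp [col, sgm]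
    have e13 : (-1 - (0 : ℕ) : ℤ) = -1 := by norm_num
    rw [e9] at e3
    refine ⟨((1 - q ^ 2) * q⁻¹ ^ 2) • F (-1), ?_, ?_, ?_⟩
    · rw [e11, e12, e13]
      generalize F (-1) = f at *
      generalize F 0 = g at *
      generalize E (-1) = e at *
      generalize T (-1) = t at *
      have hz : ∀ X : R, (q * q⁻¹ - 1) • X = 0 := fun X => by
        rw [mul_inv_cancel₀ q_ne_zero, sub_self, zero_smul]
      linear_combination (norm := (simp only [mul_add, add_mul, mul_sub, sub_mul,
        smul_mul_assoc, mul_smul_comm, mul_assoc, mul_one, one_mul]; module))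
        e1 * g + (q⁻¹ * q⁻¹) • (f * e2) - q • (e2 * f) - (q * q) • (g * e1) - q • e3
          + q⁻¹ • hz (f * (g * e)) - (q * q⁻¹) • hz (g * (f * e)) + (q * q⁻¹) • hz (f * t)
    · rw [smul_mul_assoc, mul_smul_comm, smul_comm q⁻¹]
      congr 1
      exact h.head_mul (-1) 0
    · intro w hw
      induction hw with
      | base hw =>
        rw [Set.mem_singleton_iff.1 hw, hv.t_smul, smul_assoc, e12, hv.mirror]
        rfl
      | act hx _ ih => obtain ⟨b, h1, h2, rfl⟩ := hx; push_cast at h1 h2; omega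
      | zero => simp
      | add _ _ h1 h2 => simp only [smul_add, h1, h2]
      | smul c _ h1 => 
        rw [smul_comm (T _) (c : K), smul_comm (_ • F _) (c : K), h1, smul_comm (col F _ _) (c : K), smul_comm c]
  · obtain ⟨a, ha⟩ : ∃ a : ℤ, a = -1 - (N + 1 : ℕ) := ⟨_, rfl⟩
    have e1 := hE.e_sgm_head h (a := a) (n := 2 * N + 1) (by push_cast at ha ⊢; omega)
    have e2 := hE.ef_mirror a
    have e3 := hE.t_sgm a a (2 * N + 1 + 1)
    have ha' : -1 - a = (N + 1 : ℕ) := by omega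
    have e4 : cartan a (N + 1 : ℕ) = 0 := by
      rw [cartan, if_neg (by omega), if_neg (by omega)]
    have e5 : segWeight a a (2 * N + 1 + 1) + segWeight (N + 1 : ℕ) a (2 * N + 1 + 1) = 0 := by
      rw [segWeight_eq, segWeight_eq]; push_cast at ha ⊢; split_ifs <;> omega
    rw [ha'] at e2 e3
    rw [e4, neg_zero, zpow_zero, one_smul] at e2
    rw [e5, neg_zero, zpow_zero, one_smul] at e3
    have e6 : col F (N + 1) (2 * (N + 1) + 1) = sgm F a (2 * N + 1 + 1) * F (N + 1 : ℕ)
        - q • (F (N + 1 : ℕ) * sgm F a (2 * N + 1 + 1)) := by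
      have i1 : ((N + 1 : ℕ) : ℤ) - (2 * (N + 1) + 1 : ℕ) = a := by rw [ha]; push_cast; ring
      have i2 : a + (2 * N + 1 + 1 : ℕ) + 1 = (N + 1 : ℕ) := by rw [ha]; push_cast; ring
      rw [col, i1, ← i2]; rfl
    have i3 : ((N + 1 : ℕ) : ℤ) - (2 * (N + 1) : ℕ) = a + 1 := by rw [ha]; push_cast; ring
    have e7 : col F (N + 1) (2 * (N + 1)) = sgm F (a + 1) (2 * N + 1) * F (N + 1 : ℕ)
        - q • (F (N + 1 : ℕ) * sgm F (a + 1) (2 * N + 1)) := by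
      have i2 : a + 1 + (2 * N + 1 : ℕ) + 1 = (N + 1 : ℕ) := by rw [ha]; push_cast; ring
      rw [col, i3, ← i2]; rfl
    rw [← ha]
    refine ⟨(q⁻¹ - q) • sgm F a (2 * N + 1 + 1), ?_, ?_, ?_⟩
    · rw [e6, e7]
      have hz : ∀ X : R, (q * q⁻¹ - 1) • X = 0 := fun X => by
        rw [mul_inv_cancel₀ q_ne_zero, sub_self, zero_smul]
      generalize sgm F a (2 * N + 1 + 1) = s at *
      generalize sgm F (a + 1) (2 * N + 1) = d at *
      generalize F (N + 1 : ℕ) = f at *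
      generalize E a = e at *
      generalize T a = t at *
      linear_combination (norm := (simp only [mul_add, add_mul, mul_sub, sub_mul,
        smul_mul_assoc, mul_smul_comm, mul_assoc, mul_one, one_mul]; module))
        e1 * f + q⁻¹ • (s * e2) - q • (e2 * s) - q • (f * e1) - q • e3
    · rw [smul_mul_assoc, mul_smul_comm, smul_comm q⁻¹]
      congr 1
      have := h.sgm_mul_sgm_left a 0 (2 * N + 1 + 1)
      have i1 : ((N + 1 : ℕ) : ℤ) - (2 * (N + 1) + 1 : ℕ) = a := by rw [ha]; push_cast; ring
      rw [col, i1]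
      exact this
    · intro w hw
      have hr : (1 - q ^ 2) * q⁻¹ ^ 2 = (q⁻¹ - q) * q⁻¹ := by
        field_simp [q_ne_zero]
      rw [hr, smul_assoc, mul_smul]
      congr 1
      induction hw with
      | base hw =>
        have := h.sgm_smul_eq_mirror hv.mirror (N + 1) (2 * (N + 1)) (by omega) le_rfl
        rw [if_neg (by omega), ← ha] at this
        rw [Set.mem_singleton_iff.1 hw, hv.t_smul]
        exact this
      | act hx hw ih =>
        obtain ⟨b, h1, h2, rfl⟩ := hx
        have j1 := hE.tf a b
        rw [ha'] at j1
        obtain ⟨p, p', jp, js, jz⟩ : ∃ p p' : K, T a * F b = p • (F b * T a) ∧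
            sgm F a (2 * N + 1 + 1) * F b = p' • (F b * sgm F a (2 * N + 1 + 1)) ∧
            col F (N + 1) (2 * (N + 1)) * F b = (p * p') • (F b * col F (N + 1) (2 * (N + 1))) := by
          rw [col, i3]
          have hcom : -(N + 1 : ℕ) < b → Commute (F b) (sgm F (a + 1) (2 * (N + 1))) := fun hb =>
            h.commute_sgm_of_mem (by omega) (by push_cast at *; omega)
          have hcom' : b < N → Commute (F b) (sgm F a (2 * N + 1 + 1)) := fun hb =>
            h.commute_sgm_of_mem (by push_cast at *; omega) (by push_cast at *; omega)
          by_cases hb1 : b = a + 1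
          · have : -(cartan a b + cartan (N + 1 : ℕ) b) = 1 := by
              simp only [cartan]; push_cast at *; split_ifs <;> omega
            rw [this, zpow_one] at j1
            refine ⟨q, 1, j1, ?_, ?_⟩
            · rw [one_smul]; exact (hcom' (by push_cast at *; omega)).eq.symm
            · have := h.head_mul (a + 1) (2 * N + 1)
              rw [hb1, mul_one]
              change _ = q • (F (a + 1) * sgm F (a + 1) (2 * N + 1 + 1))
              rw [this, smul_inv_smul₀ q_ne_zero]
              rfl
          · by_cases hb2 : b = N
            · have : -(cartan a b + cartan (N + 1 : ℕ) b) = 1 := by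
                simp only [cartan]; push_cast at *; split_ifs <;> omega
              rw [this, zpow_one] at j1
              refine ⟨q, q⁻¹, j1, ?_, ?_⟩
              · have := h.mul_tail a (2 * N + 1)
                have i4 : a + (2 * N + 1 : ℕ) + 1 = b := by push_cast at *; omega
                rwa [i4] at this
              · rw [mul_inv_cancel₀ q_ne_zero, one_smul]
                exact (hcom (by push_cast at *; omega)).eq.symm
            · have : -(cartan a b + cartan (N + 1 : ℕ) b) = 0 := by
                simp only [cartan]; push_cast at *; split_ifs <;> omega
              rw [this, zpow_zero] at j1
              refine ⟨1, 1, j1, ?_, ?_⟩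
              · rw [one_smul]; exact (hcom' (by push_cast at *; omega)).eq.symm
              · rw [one_mul, one_smul]; exact (hcom (by push_cast at *; omega)).eq.symm
        rw [← mul_smul (T a), jp, smul_assoc, mul_smul (F b), smul_comm (sgm F _ _) (p : K),
          ← mul_smul (sgm F _ _), js, smul_assoc, mul_smul (F b), ih, ← mul_smul (col F _ _), jz,
          smul_assoc, mul_smul (F b), smul_smul p, smul_comm (F b) (q⁻¹ : K), smul_comm q⁻¹ (p * p')]
      | zero => simp
      | add _ _ h1 h2 => simp only [smul_add, h1, h2]
      | smul c _ h1 =>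
        rw [smul_comm (T _) (c : K), smul_comm (sgm F _ _) (c : K), h1,
          smul_comm (col F _ _) (c : K), smul_comm c]

theorem e_col_pow_last (N n : ℕ) {w : V} (hw : InnerGen F v N w) :
    E (-1 - N) • col F N (2 * N + 1) ^ (n + 1) • w =
      ((1 - q ^ 2) * qgeom (2 * (n + 1))) • col F N (2 * N) • col F N (2 * N + 1) ^ n • w := by
  obtain ⟨Y, h1, h2, h3⟩ := hE.e_col_last h hv N
  have h4 : T (-1 - N) * col F N (2 * N + 1) = q⁻¹ ^ 2 • (col F N (2 * N + 1) * T (-1 - N)) := by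
    have := hE.t_sgm (-1 - N) (N - (2 * N + 1 : ℕ)) (2 * N + 1)
    rw [col, this]
    congr 1
    have : segWeight (-1 - N) (N - (2 * N + 1 : ℕ)) (2 * N + 1) +
        segWeight (-1 - (-1 - N)) (N - (2 * N + 1 : ℕ)) (2 * N + 1) = 2 := by
      rw [segWeight_eq, segWeight_eq]; push_cast; split_ifs <;> omega
    rw [this, zpow_neg, inv_pow]
    norm_cast
  have h5 := h.col_mul_col (N := N) (i := 2 * N) (j := 2 * N + 1) (by omega)
  have h0 := hE.e_inner_eq_zero hv hw (a := -1 - N) (by omega)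
  have h3 := h3 w hw
  generalize col F N (2 * N + 1) = x at *
  generalize col F N (2 * N) = z at *
  generalize E (-1 - N) = e at *
  generalize T (-1 - N) = t at *
  generalize 1 - q ^ 2 = c at *
  have hz := pow_mul_of_qcomm h5
  have ht := mul_pow_of_qcomm h4
  have hY := mul_pow_of_qcomm h2
  have hYt : ∀ n, Y • t • x ^ n • w =
      (c * q⁻¹ ^ 2 * (q⁻¹ ^ 2) ^ (2 * n)) • z • x ^ n • w := fun n => by
    rw [← mul_smul t, ht, smul_assoc, mul_smul, smul_comm Y (_ : K), ← mul_smul Y, hY, smul_assoc,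
      mul_smul, h3, smul_comm (x ^ n) (_ : K), ← mul_smul (x ^ n), hz, smul_assoc]
    simp only [smul_smul]
    congr 1
    ring
  induction n with
  | zero =>
    have hYt := hYt 0
    rw [zero_add, pow_one, ← mul_smul e, h1, add_smul, add_smul, smul_assoc, smul_assoc, mul_smul,
      h0, smul_zero, smul_zero, zero_add, mul_smul]
    simp only [pow_zero, one_smul, mul_zero, mul_one] at hYt ⊢
    rw [hYt, ← add_smul]
    congr 1
    simp [qgeom, Finset.sum_range_succ]
    ring
  | succ n ih =>
    have hxz : x • z • x ^ n • w = q⁻¹ • z • x ^ (n + 1) • w := by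
      rw [← mul_smul, h5, smul_assoc, mul_smul, ← mul_smul x, pow_succ']
    have hq : qgeom (2 * (n + 1 + 1)) =
        q⁻¹ ^ 2 * qgeom (2 * (n + 1)) + 1 + q⁻¹ ^ 2 * (q⁻¹ ^ 2) ^ (2 * (n + 1)) := by
      rw [show 2 * (n + 1 + 1) = 2 * (n + 1) + 1 + 1 by ring, qgeom_succ, qgeom_succ']
      ring
    rw [pow_succ' x (n + 1), mul_smul x, ← mul_smul e, h1, add_smul, add_smul, smul_assoc, smul_assoc,
      mul_smul, mul_smul, mul_smul, ih, hYt, smul_comm x (_ : K), hxz, hq]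
    simp only [smul_smul, ← add_smul]
    congr 1
    ring

theorem colAdj_col_pow_last (N n : ℕ) : ∃ γ : K, γ ≠ 0 ∧
    ∀ w, OuterGen F v N (2 * N + 2) w →
      colAdj E N (2 * N + 1) • col F N (2 * N + 1) ^ (n + 1) • w =
        γ • col F N (2 * N + 1) ^ n • w := by
  obtain ⟨γ, hγ, H⟩ := hE.colAdj_col_pow h hv (N := N) (j := 2 * N) le_rfl 0
  have hc := mul_ne_zero one_sub_q_sq_ne_zero (qgeom_ne_zero (n := 2 * (n + 1)) (by omega))
  have hcol := fun w hw => hE.e_col_pow_last h hv N n (w := w) hw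
  generalize (1 - q ^ 2) * qgeom (2 * (n + 1)) = c at hc hcol
  refine ⟨c * γ, mul_ne_zero hc hγ, fun w hw => ?_⟩
  have H := H (col F N (2 * N + 1) ^ n • w) ((hw.mono (by omega)).pow_smul le_rfl le_rfl n)
  simp only [zero_add, pow_one, pow_zero, one_smul] at H
  have e : (N : ℤ) - (2 * N + 1 : ℕ) = -1 - N := by push_cast; ring
  rw [colAdj, mul_smul, e, hcol w (hw.inner (by omega)), smul_comm (colAdj E N _) (_ : K), H,
    smul_smul]

theorem exists_colAdj_col_pow {N j : ℕ} (hj : j ≤ 2 * N + 1) (n : ℕ) : ∃ γ : K, γ ≠ 0 ∧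
    ∀ w, OuterGen F v N (j + 1) w →
      colAdj E N j • col F N j ^ (n + 1) • w = γ • col F N j ^ n • w := by
  rcases hj.lt_or_eq with hj | rfl
  · exact hE.colAdj_col_pow h hv (by omega) n
  · exact hE.colAdj_col_pow_last h hv N n

theorem colAdj_pow_col_pow {N j : ℕ} (hj : j ≤ 2 * N + 1) (n : ℕ) : ∃ γ : K, γ ≠ 0 ∧
    ∀ w, OuterGen F v N (j + 1) w → colAdj E N j ^ n • col F N j ^ n • w = γ • w := by
  induction n with
  | zero => exact ⟨1, one_ne_zero, fun w _ => by simp⟩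
  | succ n ih =>
    obtain ⟨γ, hγ, H⟩ := ih
    obtain ⟨γ', hγ', H'⟩ := hE.exists_colAdj_col_pow h hv hj n
    refine ⟨γ' * γ, mul_ne_zero hγ' hγ, fun w hw => ?_⟩
    rw [pow_succ (colAdj E N j), mul_smul, H' w hw, smul_comm (colAdj E N j ^ n) (_ : K), H w hw,
      smul_smul]

theorem colAdj_pow_col_pow_of_lt {N j : ℕ} (hj : j ≤ 2 * N + 1) {m n : ℕ} (hmn : m < n) {w : V}
    (hw : OuterGen F v N (j + 1) w) : colAdj E N j ^ n • col F N j ^ m • w = 0 := by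
  obtain ⟨k, rfl⟩ := Nat.exists_eq_add_of_lt hmn
  obtain ⟨γ, -, H⟩ := hE.colAdj_pow_col_pow h hv hj m
  rw [show m + k + 1 = k + 1 + m by ring, pow_add, mul_smul, H w hw, smul_comm _ γ, pow_succ,
    mul_smul, hE.colAdj_outer h hv j.lt_succ_self hj hw, smul_zero, smul_zero]

end TwistedDerivation

end Columns

/-- Linear independence of a family can be tested after stripping a leading factor that is detected
by a sequence of linear operators. -/
theorem linearIndepOn_of_peel {ι V : Type*} [AddCommGroup V] [Module K V] {f : ι → V}
    {s s' : Set ι} (deg : ι → ℕ) (er : ι → ι) (L : ℕ → V →ₗ[K] V)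
    (hmaps : ∀ m ∈ s, er m ∈ s') (hinj : ∀ m ∈ s, ∀ m' ∈ s, deg m = deg m' → er m = er m' → m = m')
    (hlt : ∀ n, ∀ m ∈ s, deg m < n → L n (f m) = 0)
    (heq : ∀ n, ∃ γ : K, γ ≠ 0 ∧ ∀ m ∈ s, deg m = n → L n (f m) = γ • f (er m))
    (hs' : LinearIndepOn K f s') : LinearIndepOn K f s := by
  rw [linearIndepOn_iff']
  intro t g ht hsum
  by_contra! hne
  obtain ⟨i₀, hi₀, hgi₀⟩ := hne
  obtain ⟨i₁, hi₁, hmax⟩ := Finset.exists_max_image (t.filter (g · ≠ 0)) deg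
    ⟨i₀, Finset.mem_filter.2 ⟨hi₀, hgi₀⟩⟩
  rw [Finset.mem_filter] at hi₁
  obtain ⟨γ, hγ, hLγ⟩ := heq (deg i₁)
  have h1 : LinearIndepOn K (f ∘ er) {m ∈ s | deg m = deg i₁} := by
    refine LinearIndepOn.comp_of_image (hs'.mono ?_) ?_
    · rintro _ ⟨m, hm, rfl⟩
      exact hmaps m hm.1
    · intro m hm m' hm' he
      exact hinj m hm.1 m' hm'.1 (hm.2.trans hm'.2.symm) he
  rw [linearIndepOn_iff'] at h1
  refine hi₁.2 (h1 (t.filter (deg · = deg i₁)) g ?_ ?_ i₁ (Finset.mem_filter.2 ⟨hi₁.1, rfl⟩))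
  · intro m hm
    rw [Finset.mem_coe, Finset.mem_filter] at hm
    exact ⟨ht hm.1, hm.2⟩
  · have h2 := congrArg (L (deg i₁)) hsum
    rw [map_sum, map_zero] at h2
    refine (smul_eq_zero.1 (?_ : γ • _ = (0 : V))).resolve_left hγ
    rw [← h2, Finset.smul_sum, Finset.sum_filter]
    refine Finset.sum_congr rfl fun m hm => ?_
    rw [map_smul]
    split_ifs with hd
    · rw [hLγ m (ht hm) hd, smul_comm, Function.comp]
    · by_cases hg : g m = 0
      · rw [hg, zero_smul]
      · have := hmax m (Finset.mem_filter.2 ⟨hm, hg⟩)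
        rw [hlt _ m (ht hm) (lt_of_le_of_ne this hd), smul_zero]

/-- The endpoints of the segment `col F N j`. -/
def colIdx (N j : ℕ) : ℤ × ℤ := (2 * (N - j) + 1, 2 * N + 1)

/-- The θ-restricted multisegments supported on the segments `col F N i` with `j ≤ i` and on
segments ending before `2 * N + 1`. -/
def thetaStage (N j : ℕ) : Set MS :=
  {m | IsTheta m ∧ ∀ p : ℤ × ℤ, m p ≠ 0 → p.2 < 2 * N + 1 ∨ (p.2 = 2 * N + 1 ∧ p.1 ≤ 2 * (N - j) + 1)}

theorem thetaStage_zero_two : thetaStage 0 2 = {0} := by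
  ext m
  constructor
  · rintro ⟨h1, h2⟩
    refine Finsupp.ext fun p => ?_
    by_contra hp
    obtain ⟨a1, a2, a3, a4, -⟩ := h1 p.1 p.2 hp
    rcases h2 p hp with h | h
    · simp only [Nat.cast_zero] at h
      have : p.2 = 0 := by omega
      rw [this] at a2; exact absurd a2 (by decide)
    · push_cast at h; omega
  · rintro rfl
    exact ⟨fun i j h => absurd rfl h, fun p h => absurd rfl h⟩

theorem thetaStage_last (N : ℕ) : thetaStage (N + 1) (2 * (N + 1) + 2) = thetaStage N 0 := by
  ext m
  refine and_congr_right fun h1 => forall_congr' fun p => forall_congr' fun hp => ?_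
  obtain ⟨⟨a, ha⟩, ⟨b, hb⟩, a3, a4, -⟩ := h1 p.1 p.2 hp
  push_cast
  omega

theorem erase_mem_thetaStage {N j : ℕ} {m : MS} (hm : m ∈ thetaStage N j) :
    m.erase (colIdx N j) ∈ thetaStage N (j + 1) := by
  have key : ∀ p, m.erase (colIdx N j) p ≠ 0 → p ≠ colIdx N j ∧ m p ≠ 0 := by
    intro p hp
    have : p ≠ colIdx N j := by rintro rfl; simp at hp
    exact ⟨this, by rwa [Finsupp.erase_ne this] at hp⟩
  refine ⟨fun i k h => ?_, fun p h => ?_⟩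
  · obtain ⟨h1, h2⟩ := key _ h
    rw [Finsupp.erase_ne h1]
    exact hm.1 i k h2
  · obtain ⟨h1, h2⟩ := key _ h
    obtain ⟨⟨a, ha⟩, ⟨b, hb⟩, a3, a4, -⟩ := hm.1 p.1 p.2 h2
    have h3 := hm.2 p h2
    have h4 : ¬ (p.1 = 2 * (N - j) + 1 ∧ p.2 = 2 * N + 1) := fun h => h1 (Prod.ext h.1 h.2)
    push_cast
    omega

theorem nonneg_of_mem_thetaStage {N j : ℕ} {m : MS} (hm : m ∈ thetaStage N j) (p : ℤ × ℤ) :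
    0 ≤ m p := by
  by_cases hp : m p = 0
  · exact hp.ge
  · exact (hm.1 p.1 p.2 hp).2.2.2.2.le

theorem apply_colIdx_of_mem_thetaStage {N j : ℕ} {m : MS} (hm : m ∈ thetaStage N (j + 1)) :
    m (colIdx N j) = 0 := by
  by_contra hp
  have := hm.2 _ hp
  simp only [colIdx] at this
  push_cast at this
  omega

theorem update_mem_thetaStage {N j : ℕ} (hj : j ≤ 2 * N + 1) {m : MS}
    (hm : m ∈ thetaStage N (j + 1)) (n : ℕ) : m.update (colIdx N j) n ∈ thetaStage N j := by
  have key : ∀ p, m.update (colIdx N j) n p ≠ 0 → p = colIdx N j ∨ m p ≠ 0 := by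
    intro p hp
    by_cases h : p = colIdx N j
    · exact .inl h
    · rw [Finsupp.update_apply, if_neg h] at hp
      exact .inr hp
  refine ⟨fun i k h => ?_, fun p h => ?_⟩
  · by_cases hik : (i, k) = colIdx N j
    · rw [Finsupp.update_apply, if_pos hik] at h ⊢
      obtain ⟨rfl, rfl⟩ := Prod.mk.inj hik
      refine ⟨⟨_, rfl⟩, ⟨_, rfl⟩, ?_, ?_, ?_⟩ <;> omega
    · rw [Finsupp.update_apply, if_neg hik] at h ⊢
      exact hm.1 i k h
  · rcases key p h with rfl | h
    · right; exact ⟨rfl, le_rfl⟩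
    · have := hm.2 p h
      push_cast at this
      omega

theorem stage_induction {P : ℕ → ℕ → Prop} (h0 : P 0 2)
    (hcol : ∀ N, P N 0 → P (N + 1) (2 * (N + 1) + 2))
    (hstep : ∀ N j, j ≤ 2 * N + 1 → P N (j + 1) → P N j) (N : ℕ) {j : ℕ} (hj : j ≤ 2 * N + 2) :
    P N j := by
  have key : ∀ N, P N (2 * N + 2) → ∀ j, j ≤ 2 * N + 2 → P N j := fun N h j hj =>
    Nat.decreasingInduction' (fun k hk _ => hstep N k (by omega)) hj h
  induction N generalizing j with
  | zero => exact key 0 h0 j hj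
  | succ N ih => exact key _ (hcol N (ih (Nat.zero_le _))) j hj

section Stages

variable {R : Type*} [Ring R] [Algebra K R]
variable {V : Type*} [AddCommGroup V] [Module K V] [Module R V] [IsScalarTower K R V]

/-- A family of vectors indexed by multisegments, built by applying divided powers of segments in
decreasing order to `v`. -/
structure IsStageFamily (F : ℤ → R) (v : V) (f : MS → V) : Prop where
  zero : f 0 = v
  step : ∀ {N j : ℕ} {m : MS}, j ≤ 2 * N + 1 → m ∈ thetaStage N j →
    f m = colPow F N j (m (colIdx N j)).toNat • f (m.erase (colIdx N j))

namespace IsStageFamily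

variable {F E T : ℤ → R} {v : V} {f : MS → V} (hf : IsStageFamily F v f)

theorem colPow_eq_smul (F : ℤ → R) (N j n : ℕ) :
    ∃ c : K, c ≠ 0 ∧ colPow F N j n = c • col F N j ^ n :=
  ⟨_, inv_ne_zero (gfact_ne_zero (by split_ifs <;> omega) n), rfl⟩

include hf

theorem outerGen (N : ℕ) {j : ℕ} (hj : j ≤ 2 * N + 2) :
    ∀ m ∈ thetaStage N j, OuterGen F v N j (f m) := by
  refine stage_induction (P := fun N j => ∀ m ∈ thetaStage N j, OuterGen F v N j (f m))
    ?_ ?_ ?_ N hj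
  · rw [thetaStage_zero_two]
    rintro _ rfl
    rw [hf.zero]
    exact .base (.base rfl)
  · intro N h m hm
    rw [thetaStage_last] at hm
    exact .base (h m hm).inner_succ
  · intro N j hj ih m hm
    rw [hf.step hj hm]
    obtain ⟨c, -, hc⟩ := colPow_eq_smul F N j (m (colIdx N j)).toNat
    rw [hc, smul_assoc]
    exact .smul _ (((ih _ (erase_mem_thetaStage hm)).mono j.le_succ).pow_smul le_rfl hj _)

theorem linearIndepOn (hE : TwistedDerivation F E T) (h : SerreFamily F)
    (hv : IsVacuum F E T v) (hv0 : v ≠ 0) (N : ℕ) {j : ℕ} (hj : j ≤ 2 * N + 2) :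
    LinearIndepOn K f (thetaStage N j) := by
  refine stage_induction (P := fun N j => LinearIndepOn K f (thetaStage N j)) ?_ ?_ ?_ N hj
  · rw [thetaStage_zero_two]
    exact LinearIndepOn.singleton (by rwa [hf.zero])
  · intro N h
    rwa [thetaStage_last]
  · intro N j hj ih
    have hout : ∀ m ∈ thetaStage N j, OuterGen F v N (j + 1) (f (m.erase (colIdx N j))) :=
      fun m hm => hf.outerGen N (by omega) _ (erase_mem_thetaStage hm)
    refine linearIndepOn_of_peel (fun m => (m (colIdx N j)).toNat) (fun m => m.erase (colIdx N j))
      (fun n => DistribSMul.toLinearMap K V (colAdj E N j ^ n))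
      (fun m hm => erase_mem_thetaStage hm) (fun m hm m' hm' h1 h2 => ?_) (fun n m hm h1 => ?_)
      (fun n => ?_) ih
    · refine Finsupp.ext fun p => ?_
      by_cases hp : p = colIdx N j
      · have h3 := nonneg_of_mem_thetaStage hm (colIdx N j)
        have h4 := nonneg_of_mem_thetaStage hm' (colIdx N j)
        rw [hp]
        omega
      · have := DFunLike.congr_fun h2 p
        rwa [Finsupp.erase_ne hp, Finsupp.erase_ne hp] at this
    · obtain ⟨c, -, hc⟩ := colPow_eq_smul F N j (m (colIdx N j)).toNat
      rw [hf.step hj hm, hc, smul_assoc, map_smul]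
      exact (congrArg _ (hE.colAdj_pow_col_pow_of_lt h hv hj h1 (hout m hm))).trans (smul_zero _)
    · obtain ⟨γ, hγ, hγ'⟩ := hE.colAdj_pow_col_pow h hv hj n
      obtain ⟨c, hc0, hc⟩ := colPow_eq_smul F N j n
      refine ⟨c * γ, mul_ne_zero hc0 hγ, fun m hm h1 => ?_⟩
      rw [hf.step hj hm, h1, hc, smul_assoc, map_smul, mul_smul]
      exact congrArg _ (hγ' _ (hout m hm))

theorem span_eq (h : SerreFamily F) (hv : ∀ a, F a • v = F (-1 - a) • v) (N : ℕ) {j : ℕ}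
    (hj : j ≤ 2 * N + 2) :
    Submodule.span AA (f '' thetaStage N j) = colModule F v N (2 * N + 2 - j) := by
  refine stage_induction (P := fun N j =>
    Submodule.span AA (f '' thetaStage N j) = colModule F v N (2 * N + 2 - j)) ?_ ?_ ?_ N hj
  · rw [thetaStage_zero_two, Set.image_singleton, hf.zero]
    refine le_antisymm (Submodule.span_le.2 ?_) ?_
    · rintro _ rfl
      exact self_mem_intModule 0
    · refine intModule_le (fun a n h1 h2 => ?_) (Submodule.subset_span rfl)
      push_cast at h1 h2; omega
  · intro N ih
    rw [thetaStage_last, ih, Nat.sub_zero, Nat.sub_self, ← h.intModule_succ hv]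
    rfl
  · intro N j hj ih
    obtain ⟨k, hk⟩ : ∃ k, 2 * N + 1 = j + k := ⟨2 * N + 1 - j, by omega⟩
    rw [show 2 * N + 2 - (j + 1) = k by omega] at ih
    have hkj : 2 * N + 1 - k = j := by omega
    rw [show 2 * N + 2 - j = k + 1 by omega]
    refine le_antisymm (Submodule.span_le.2 ?_) (Submodule.span_le.2 ?_)
    · rintro _ ⟨m, hm, rfl⟩
      rw [hf.step hj hm]
      refine Submodule.subset_span ⟨(m (colIdx N j)).toNat, _, ?_, by rw [hkj]⟩
      rw [← ih]
      exact Submodule.subset_span ⟨_, erase_mem_thetaStage hm, rfl⟩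
    · rintro _ ⟨n, w, hw, rfl⟩
      rw [← ih] at hw
      refine smul_mem_of_mem_span ?_ hw
      rintro _ ⟨m, hm, rfl⟩
      refine Submodule.subset_span ⟨_, update_mem_thetaStage hj hm n, ?_⟩
      rw [hf.step hj (update_mem_thetaStage hj hm n), hkj]
      congr 2
      · simp [Finsupp.update_apply]
      · refine Finsupp.ext fun p => ?_
        by_cases hp : p = colIdx N j
        · rw [hp, Finsupp.erase_same, apply_colIdx_of_mem_thetaStage hm]
        · rw [Finsupp.erase_ne hp, Finsupp.update_apply, if_neg hp]

theorem mem_intModule_iff (h : SerreFamily F) (hv : ∀ a, F a • v = F (-1 - a) • v) {N : ℕ} {w : V} :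
    w ∈ intModule F v (N + 1) ↔ ∃ c : MS →₀ K, (∀ m ∈ c.support, m ∈ thetaStage N 0) ∧
      (∀ m, c m ∈ AA) ∧ w = c.sum fun m a => a • f m := by
  rw [h.intModule_succ hv, ← Nat.sub_zero (2 * N + 2), ← hf.span_eq h hv N (Nat.zero_le _)]
  constructor
  · intro hw
    rw [Finsupp.mem_span_image_iff_linearCombination] at hw
    obtain ⟨l, hl, rfl⟩ := hw
    refine ⟨l.mapRange (Subtype.val : AA → K) rfl, fun m hm => hl (Finsupp.support_mapRange hm),
      fun m => (l m).2, ?_⟩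
    rw [Finsupp.sum_mapRange_index fun m => zero_smul K (f m), Finsupp.linearCombination_apply]
    rfl
  · rintro ⟨c, hc, hcA, rfl⟩
    exact sum_mem fun m hm => AA_smul_mem (hcA m) (Submodule.subset_span ⟨m, hc m hm, rfl⟩)

end IsStageFamily

end Stages

section Transfer

variable {R S : Type*} [Ring R] [Algebra K R] [Ring S] [Algebra K S] (ρ : R →ₐ[K] S) (F : ℤ → R)

theorem map_sgm (a : ℤ) (n : ℕ) : ρ (sgm F a n) = sgm (fun a => ρ (F a)) a n := by
  induction n with
  | zero => rfl
  | succ n ih => rw [sgm_succ, sgm_succ, map_sub, map_smul, map_mul, map_mul, ih]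

theorem map_colPow (N j n : ℕ) : ρ (colPow F N j n) = colPow (fun a => ρ (F a)) N j n := by
  simp only [colPow, col, gdp, map_smul, map_pow, map_sgm]

theorem SerreFamily.map {F : ℤ → R} (h : SerreFamily F) : SerreFamily fun a => ρ (F a) where
  far a b hab := (h.far a b hab).map ρ
  serre a b hab := by simpa only [map_add, map_smul, map_mul] using congrArg ρ (h.serre a b hab)

end Transfer

/-- The generators of `U_q^-(gl_∞)`, indexed by the integers. -/
def gen (a : ℤ) : U := RingQuot.mkAlgHom K URel (FreeAlgebra.ι K a)

theorem fgen_eq_gen (a : ℤ) : fgen (2 * a + 1) = gen a := by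
  rw [fgen, gen, show (2 * a + 1 - 1) / 2 = a by omega]

theorem serreFamily_gen : SerreFamily gen where
  far a b hab := by
    have := RingQuot.mkAlgHom_rel K (URel.far a b hab)
    rwa [map_mul, map_mul] at this
  serre a b hab := by
    have := RingQuot.mkAlgHom_rel K (URel.serre a b hab)
    simp only [map_mul, map_add, map_smul] at this
    change gen a * gen a * gen b + gen b * (gen a * gen a) = _ • (gen a * gen b * gen a) at this
    rw [← smul_add, mul_assoc (gen b), this, smul_smul]
    congr 1
    field_simp [q_ne_zero]

section Lift

variable {S : Type*} [Ring S] [Algebra K S] {A : ℤ → S}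

/-- The representation of `U_q^-(gl_∞)` attached to a family satisfying the Serre relations. -/
def SerreFamily.lift (hA : SerreFamily A) : U →ₐ[K] S :=
  RingQuot.liftAlgHom K ⟨FreeAlgebra.lift K A, by
    rintro _ _ (⟨a, b, hab⟩ | ⟨a, b, hab⟩)
    · simpa using (hA.far a b hab).eq
    · have h1 := congrArg (q⁻¹ • ·) (hA.serre a b hab)
      simp only [smul_add, smul_smul, inv_mul_cancel₀ q_ne_zero, one_smul] at h1
      simp only [map_add, map_mul, map_smul, FreeAlgebra.lift_ι_apply]
      rw [← mul_assoc (A b), h1]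
      congr 1
      field_simp [q_ne_zero]⟩

theorem SerreFamily.lift_gen (hA : SerreFamily A) (a : ℤ) : hA.lift (gen a) = A a := by
  rw [SerreFamily.lift, gen, RingQuot.liftAlgHom_mkAlgHom_apply, FreeAlgebra.lift_ι_apply]

end Lift

theorem gen_smul_phi (a : ℤ) : gen a • phi = gen (-1 - a) • phi := by
  rw [phi, ← Submodule.Quotient.mk_smul, ← Submodule.Quotient.mk_smul, Submodule.Quotient.eq,
    smul_eq_mul, smul_eq_mul, mul_one, mul_one]
  refine Ideal.subset_span ⟨2 * a + 1, ⟨a, rfl⟩, ?_⟩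
  rw [fgen_eq_gen, show -(2 * a + 1) = 2 * (-1 - a) + 1 by ring, fgen_eq_gen]

theorem exists_eq_smul_phi (w : Vt) : ∃ u : U, w = u • phi := by
  obtain ⟨u, rfl⟩ := Submodule.Quotient.mk_surjective _ w
  exact ⟨u, by rw [phi, ← Submodule.Quotient.mk_smul, smul_eq_mul, mul_one]⟩

section LiftV

variable {M : Type*} [AddCommGroup M] [Module K M] {A : ℤ → Module.End K M}

theorem SerreFamily.exists_lift (hA : SerreFamily A) {m₀ : M} (hm : ∀ a, A a m₀ = A (-1 - a) m₀) :
    ∃ g : Vt →ₗ[K] M, g phi = m₀ ∧ ∀ a w, g (gen a • w) = A a (g w) := by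
  let ev : U →ₗ[K] M := (LinearMap.applyₗ m₀).comp hA.lift.toLinearMap
  have hev : ∀ u, ev u = hA.lift u m₀ := fun u => rfl
  have hJ : ∀ u ∈ Jideal, ev u = 0 := by
    intro u hu
    refine Submodule.span_induction ?_ ?_ ?_ ?_ hu
    · rintro _ ⟨k, ⟨a, rfl⟩, rfl⟩
      rw [fgen_eq_gen, show -(2 * a + 1) = 2 * (-1 - a) + 1 by ring, fgen_eq_gen, map_sub, hev, hev,
        hA.lift_gen, hA.lift_gen, hm, sub_self]
    · exact map_zero ev
    · intro x y _ _ hx hy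
      rw [map_add, hx, hy, add_zero]
    · intro a x _ hx
      rw [hev] at hx ⊢
      rw [smul_eq_mul, map_mul, Module.End.mul_apply, hx, map_zero]
  let g : Vt →ₗ[K] M := (Submodule.liftQ (Jideal.restrictScalars K) ev fun u hu => hJ u hu).comp
    (Submodule.Quotient.restrictScalarsEquiv K Jideal).symm.toLinearMap
  have hg : ∀ u, g (Submodule.Quotient.mk u) = ev u := fun u => rfl
  refine ⟨g, ?_, fun a w => ?_⟩
  · rw [phi, hg, hev, map_one, Module.End.one_apply]
  · obtain ⟨u, rfl⟩ := Submodule.Quotient.mk_surjective _ w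
    rw [← Submodule.Quotient.mk_smul, hg, hg, hev, hev, smul_eq_mul, map_mul, hA.lift_gen,
      Module.End.mul_apply]

end LiftV

theorem phi_ne_zero : phi ≠ 0 := by
  have hA : SerreFamily fun _ : ℤ => (0 : Module.End K K) :=
    ⟨fun _ _ _ => Commute.refl _, fun _ _ _ => by simp⟩
  obtain ⟨g, hg, -⟩ := hA.exists_lift (m₀ := (1 : K)) (fun _ => rfl)
  intro h
  rw [h, map_zero] at hg
  exact zero_ne_one hg

/-- The operator on `Ṽ_θ(0)` given by a generator. -/
def genEnd (a : ℤ) : Module.End K Vt := Algebra.lsmul K K Vt (gen a)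

theorem genEnd_apply (a : ℤ) (w : Vt) : genEnd a w = gen a • w := rfl

theorem serreFamily_genEnd : SerreFamily genEnd := serreFamily_gen.map (Algebra.lsmul K K Vt)

theorem induction_phi {P : Vt → Prop} (h0 : P phi) (hadd : ∀ w w', P w → P w' → P (w + w'))
    (hsmul : ∀ (c : K) w, P w → P (c • w)) (hgen : ∀ a w, P w → P (gen a • w)) (w : Vt) : P w := by
  obtain ⟨u, rfl⟩ := exists_eq_smul_phi w
  have key : ∀ (x : FreeAlgebra K ℤ) w, P w → P (RingQuot.mkAlgHom K URel x • w) := by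
    intro x
    induction x with
    | grade0 c => intro w hw; rw [AlgHom.commutes, algebraMap_smul]; exact hsmul c w hw
    | grade1 a => exact hgen a
    | mul x y hx hy => intro w hw; rw [map_mul, mul_smul]; exact hx _ (hy _ hw)
    | add x y hx hy => intro w hw; rw [map_add, add_smul]; exact hadd _ _ (hx _ hw) (hy _ hw)
  obtain ⟨x, rfl⟩ := RingQuot.mkAlgHom_surjective K URel u
  exact key x phi h0

theorem SerreFamily.scale {R : Type*} [Ring R] [Algebra K R] {F : ℤ → R} (h : SerreFamily F)
    (χ : ℤ → K) : SerreFamily fun a => χ a • F a where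
  far a b hab := ((h.far a b hab).smul_left _).smul_right _
  serre a b hab := by
    simp only [smul_mul_smul_comm]
    linear_combination (norm := module) (χ a * χ a * χ b) • h.serre a b hab

theorem cartan_mirror (a b : ℤ) : cartan a (-1 - b) = cartan (-1 - a) b := by
  simp only [cartan]
  split_ifs <;> first | rfl | omega

theorem exists_t (a : ℤ) : ∃ T : Module.End K Vt, T phi = phi ∧ ∀ b w,
    T (genEnd b w) = (q ^ (-cartan a b) * q ^ (-cartan (-1 - a) b)) • genEnd b (T w) := by
  obtain ⟨T, h1, h2⟩ := (serreFamily_genEnd.scale fun b =>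
    q ^ (-cartan a b) * q ^ (-cartan (-1 - a) b)).exists_lift (m₀ := phi) fun b => by
      rw [LinearMap.smul_apply, LinearMap.smul_apply, genEnd_apply, gen_smul_phi, genEnd_apply,
        cartan_mirror, cartan_mirror, sub_sub_cancel, mul_comm]
  exact ⟨T, h1, h2⟩

/-- The indicator of the generator `a`. -/
def delta (a b : ℤ) : K := if a = b then 1 else 0

theorem delta_mul_far {a b c : ℤ} (h : 1 < |b - c|) :
    delta a b * (q ^ (-cartan a c) - 1) = 0 := by
  rw [lt_abs] at h
  rw [delta]
  split_ifs with hab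
  · subst hab
    rw [cartan, if_neg (by omega), if_neg (by omega)]
    simp
  · exact zero_mul _

theorem cartan_self (a : ℤ) : cartan a a = 2 := if_pos rfl

theorem cartan_of_adj {a b : ℤ} (h : |a - b| = 1) : cartan a b = -1 := by
  rw [abs_eq zero_le_one] at h
  rw [cartan, if_neg (by omega), if_pos (by omega)]

theorem delta_mul_serre_outer {a b c : ℤ} (h : |b - c| = 1) : delta a c *
    (q * ((q ^ (-cartan a b)) ^ 2 + 1) - (q ^ 2 + 1) * q ^ (-cartan a b)) = 0 := by
  rw [delta]
  split_ifs with hab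
  · subst hab
    rw [cartan_of_adj (by rwa [abs_sub_comm]), neg_neg, zpow_one]
    ring
  · exact zero_mul _

theorem delta_mul_serre_left {a b c : ℤ} (h : |b - c| = 1) : delta a b *
    (q * (1 + q ^ (-cartan a b)) - (q ^ 2 + 1) * (q ^ (-cartan a b) * q ^ (-cartan a c))) = 0 := by
  rw [delta]
  split_ifs with hab
  · subst hab
    rw [cartan_of_adj h, cartan_self, neg_neg, zpow_one, zpow_neg]
    have := q_ne_zero
    norm_cast
    field_simp
    ring
  · exact zero_mul _

theorem delta_mul_serre_right {a b c : ℤ} (h : |b - c| = 1) : delta a b *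
    (q * (q ^ (-cartan a c) + q ^ (-cartan a c) * q ^ (-cartan a b)) - (q ^ 2 + 1)) = 0 := by
  rw [delta]
  split_ifs with hab
  · subst hab
    rw [cartan_of_adj h, cartan_self, neg_neg, zpow_one, zpow_neg]
    have := q_ne_zero
    norm_cast
    field_simp
    ring
  · exact zero_mul _

/-- The extension of `Ṽ_θ(0)` by itself whose off-diagonal entry computes `E a`. -/
def extEnd (T : Module.End K Vt) (a b : ℤ) : Module.End K (Vt × Vt) :=
  ((genEnd b).comp (LinearMap.fst K Vt Vt)).prod
    (q ^ (-cartan a b) • (genEnd b).comp (LinearMap.snd K Vt Vt)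
      + (delta a b • LinearMap.id + delta (-1 - a) b • T).comp (LinearMap.fst K Vt Vt))

theorem extEnd_apply (T : Module.End K Vt) (a b : ℤ) (x y : Vt) : extEnd T a b (x, y) =
    (genEnd b x, q ^ (-cartan a b) • genEnd b y + (delta a b • x + delta (-1 - a) b • T x)) := rfl

theorem serreFamily_extEnd {T : Module.End K Vt} {a : ℤ} (hT : ∀ b w,
    T (genEnd b w) = (q ^ (-cartan a b) * q ^ (-cartan (-1 - a) b)) • genEnd b (T w)) :
    SerreFamily (extEnd T a) where
  far b c hbc := by
    have h0 : ∀ w, genEnd b (genEnd c w) = genEnd c (genEnd b w) := fun w =>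
      DFunLike.congr_fun (serreFamily_genEnd.far b c hbc).eq w
    have hcb : 1 < |c - b| := by rwa [abs_sub_comm]
    refine LinearMap.ext fun ⟨x, y⟩ => Prod.ext ?_ ?_
    · exact h0 x
    · have h1 := delta_mul_far (a := a) hbc
      have h2 := delta_mul_far (a := a) hcb
      have h3 := delta_mul_far (a := -1 - a) hbc
      have h4 := delta_mul_far (a := -1 - a) hcb
      simp only [Module.End.mul_apply, extEnd_apply, map_add, map_smul, hT, h0]
      linear_combination (norm := module) h2 • genEnd b x - h1 • genEnd c x
        + (q ^ (-cartan a c) * h3) • genEnd c (T x) - (q ^ (-cartan a b) * h4) • genEnd b (T x)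
  serre b c hbc := by
    have h0 : ∀ w, _ := fun w => DFunLike.congr_fun (serreFamily_genEnd.serre b c hbc) w
    simp only [LinearMap.add_apply, LinearMap.smul_apply, Module.End.mul_apply] at h0
    refine LinearMap.ext fun ⟨x, y⟩ => Prod.ext ?_ ?_
    · exact h0 x
    · have h1 := delta_mul_serre_outer (a := a) hbc
      have h2 := delta_mul_serre_left (a := a) hbc
      have h3 := delta_mul_serre_right (a := a) hbc
      have h1' := delta_mul_serre_outer (a := -1 - a) hbc
      have h2' := delta_mul_serre_left (a := -1 - a) hbc
      have h3' := delta_mul_serre_right (a := -1 - a) hbc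
      simp only [LinearMap.add_apply, LinearMap.smul_apply, Module.End.mul_apply, extEnd_apply,
        map_add, map_smul, hT, Prod.smul_mk, Prod.mk_add_mk]
      generalize q ^ (-cartan a b) = s at *
      generalize q ^ (-cartan a c) = t at *
      generalize q ^ (-cartan (-1 - a) b) = s' at *
      generalize q ^ (-cartan (-1 - a) c) = t' at *
      linear_combination (norm := module) (s * s * t) • h0 y
        + h1 • genEnd b (genEnd b x) + h2 • genEnd b (genEnd c x) + h3 • genEnd c (genEnd b x)
        + (s * s * h1') • genEnd b (genEnd b (T x)) + (s * t * h3') • genEnd b (genEnd c (T x))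
        + (s * t * h2') • genEnd c (genEnd b (T x))

theorem exists_e {T : Module.End K Vt} {a : ℤ} (hphi : T phi = phi) (hT : ∀ b w,
    T (genEnd b w) = (q ^ (-cartan a b) * q ^ (-cartan (-1 - a) b)) • genEnd b (T w)) :
    ∃ E : Module.End K Vt, E phi = 0 ∧ ∀ b w, E (genEnd b w) =
      q ^ (-cartan a b) • genEnd b (E w) + (delta a b • w + delta (-1 - a) b • T w) := by
  obtain ⟨g, h1, h2⟩ := (serreFamily_extEnd hT).exists_lift (m₀ := ((phi, 0) : Vt × Vt)) fun b => by
    rw [extEnd_apply, extEnd_apply, map_zero, map_zero, hphi, genEnd_apply, gen_smul_phi,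
      genEnd_apply]
    have h3 : delta a (-1 - b) = delta (-1 - a) b := if_congr (by omega) rfl rfl
    have h4 : delta (-1 - a) (-1 - b) = delta a b := if_congr (by omega) rfl rfl
    rw [h3, h4]
    congr 1
    module
  have h3 : ∀ w, (g w).1 = w := by
    refine induction_phi (by rw [h1]) (fun w w' h h' => ?_) (fun c w h => ?_) fun b w h => ?_
    · rw [map_add, Prod.fst_add, h, h']
    · rw [map_smul, Prod.smul_fst, h]
    · rw [h2]
      exact congrArg (gen b • ·) h
  refine ⟨(LinearMap.snd K Vt Vt).comp g, by simp [h1], fun b w => ?_⟩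
  have h4 := congrArg Prod.snd (h2 b w)
  have h5 : g w = (w, (g w).2) := Prod.ext (h3 w) rfl
  rw [h5, extEnd_apply] at h4
  exact h4

theorem exists_twistedDerivation : ∃ E T : ℤ → Module.End K Vt,
    TwistedDerivation genEnd E T ∧ IsVacuum genEnd E T phi := by
  choose T hT1 hT2 using exists_t
  choose E hE1 hE2 using fun a => exists_e (hT1 a) (hT2 a)
  refine ⟨E, T, ⟨fun a b => LinearMap.ext fun w => ?_, fun a b => LinearMap.ext fun w => ?_⟩,
    gen_smul_phi, hE1, hT1⟩
  · refine (hE2 a b w).trans ?_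
    simp only [delta]
    split_ifs <;> simp only [LinearMap.add_apply, LinearMap.smul_apply, Module.End.mul_apply,
      Module.End.one_apply, LinearMap.zero_apply] <;> module
  · refine (hT2 a b w).trans ?_
    rw [← q_zpow_add, ← neg_add]
    rfl

/-! ### Products of modified divided powers -/

/-- The strict PBW order on segments. -/
def pbwGt (p p' : ℤ × ℤ) : Prop := p'.2 < p.2 ∨ p'.2 = p.2 ∧ p'.1 < p.1

theorem box_eq (B : ℕ) : box B = (List.range (2 * B + 1)).flatMap fun a =>
    (List.range (2 * B + 1)).map fun b => ((B : ℤ) - (b : ℕ), (B : ℤ) - (a : ℕ)) := by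
  simp [box, List.flatMap_map, Function.comp_def, ← List.map_eq_flatMap]

theorem pairwise_box (B : ℕ) : (box B).Pairwise pbwGt := by
  rw [box_eq, List.pairwise_flatMap]
  refine ⟨fun a _ => ?_, ?_⟩
  · rw [List.pairwise_map]
    refine List.pairwise_lt_range.imp fun h => Or.inr ⟨rfl, ?_⟩
    dsimp only
    omega
  · refine List.pairwise_lt_range.imp fun h => ?_
    intro x hx y hy
    obtain ⟨b, -, rfl⟩ := List.mem_map.1 hx
    obtain ⟨c, -, rfl⟩ := List.mem_map.1 hy
    left
    dsimp only
    omega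

theorem mem_box {B : ℕ} {p : ℤ × ℤ} (h : max p.1.natAbs p.2.natAbs ≤ B) : p ∈ box B := by
  rw [max_le_iff] at h
  rw [box_eq]
  refine List.mem_flatMap.2 ⟨(B - p.2).toNat, List.mem_range.2 (by omega),
    List.mem_map.2 ⟨(B - p.1).toNat, List.mem_range.2 (by omega), Prod.ext ?_ ?_⟩⟩ <;>
  dsimp only <;> omega

theorem le_bound {m : MS} {p : ℤ × ℤ} (h : m p ≠ 0) : max p.1.natAbs p.2.natAbs ≤ bound m :=
  Finset.le_sup (f := fun p : ℤ × ℤ => max p.1.natAbs p.2.natAbs) (Finsupp.mem_support_iff.2 h)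

theorem segPowM_zero (i j : ℤ) : segPowM i j 0 = 1 := by simp [segPowM, segPow, qfact]

/-- The product of the modified divided powers `⟨i,j⟩^{[m_{i,j}]}` along a list of segments. -/
def listProd (l : List (ℤ × ℤ)) (m : MS) : U := (l.map fun p => segPowM p.1 p.2 (m p)).prod

theorem listProd_filter (l : List (ℤ × ℤ)) (m : MS) :
    listProd (l.filter (m · ≠ 0)) m = listProd l m := by
  induction l with
  | nil => rfl
  | cons p l ih =>
    by_cases hp : m p = 0
    · rw [List.filter_cons_of_neg (by simpa using hp), ih]
      simp [listProd, hp, segPowM_zero]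
    · rw [List.filter_cons_of_pos (by simpa using hp)]
      simp only [listProd, List.map_cons, List.prod_cons] at ih ⊢
      rw [ih]

theorem PthetaProd_eq_listProd {m : MS} {l : List (ℤ × ℤ)} (hl : l.Pairwise pbwGt)
    (hm : ∀ p, m p ≠ 0 → p ∈ l) : PthetaProd m = listProd l m := by
  change listProd (box (bound m)) m = _
  have hirr : ∀ {l : List (ℤ × ℤ)}, l.Pairwise pbwGt → l.Nodup := fun hl =>
    hl.imp fun h => by rintro rfl; rcases h with h | h <;> omega
  have h1 := (pairwise_box (bound m)).filter (fun p => decide (m p ≠ 0))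
  have h2 := hl.filter (fun p => decide (m p ≠ 0))
  rw [← listProd_filter, ← listProd_filter l]
  congr 1
  refine List.Perm.eq_of_pairwise (le := pbwGt) (fun p p' _ _ h h' => ?_) h1 h2
    ((List.perm_ext_iff_of_nodup (hirr h1) (hirr h2)).2 fun p => ?_)
  · rcases h with h | h <;> rcases h' with h' | h' <;> omega
  · simp only [List.mem_filter, decide_eq_true_eq]
    exact ⟨fun h => ⟨hm p h.2, h.2⟩, fun h => ⟨mem_box (le_bound h.2), h.2⟩⟩

theorem segAux_eq_sgm (a : ℤ) (n : ℕ) : segAux (2 * a + 1) n = sgm gen a n := by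
  induction n with
  | zero => rw [segAux, fgen_eq_gen, sgm_zero]
  | succ n ih =>
    rw [segAux, sgm_succ, ih, show 2 * a + 1 + 2 * ((n : ℤ) + 1) = 2 * (a + n + 1) + 1 by ring,
      fgen_eq_gen]

theorem segPowM_colIdx {N j : ℕ} {n : ℤ} (hn : 0 ≤ n) :
    segPowM (colIdx N j).1 (colIdx N j).2 n = colPow gen N j n.toNat := by
  have h1 : seg (colIdx N j).1 (colIdx N j).2 = col gen N j := by
    rw [seg, colIdx, segAux_eq_sgm, col]
    congr
    dsimp only
    omega
  have h2 : (colIdx N j).1 = -(colIdx N j).2 ↔ j = 2 * N + 1 := by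
    simp only [colIdx]
    omega
  rw [segPowM, segPow, if_neg hn.not_gt, if_neg hn.not_gt, h1, colPow, gdp, qfact_eq_gfact]
  simp only [h2]
  split_ifs <;> rfl

theorem PthetaProd_step {N j : ℕ} {m : MS} (hm : m ∈ thetaStage N j) :
    PthetaProd m = colPow gen N j (m (colIdx N j)).toNat * PthetaProd (m.erase (colIdx N j)) := by
  let l := (box (bound m)).filter fun p => decide (p ≠ colIdx N j ∧ m p ≠ 0)
  have hmem : ∀ p, p ∈ l ↔ p ≠ colIdx N j ∧ m p ≠ 0 := fun p => by
    simp only [l, List.mem_filter, decide_eq_true_eq]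
    exact ⟨And.right, fun h => ⟨mem_box (le_bound h.2), h⟩⟩
  have hl : l.Pairwise pbwGt := (pairwise_box _).filter _
  have hl' : (colIdx N j :: l).Pairwise pbwGt := by
    refine List.pairwise_cons.2 ⟨fun p hp => ?_, hl⟩
    obtain ⟨h1, h2⟩ := (hmem p).1 hp
    have h3 := hm.2 p h2
    have h4 : ¬ (p.1 = 2 * (N - j) + 1 ∧ p.2 = 2 * N + 1) := fun h => h1 (Prod.ext h.1 h.2)
    simp only [pbwGt, colIdx]
    omega
  rw [PthetaProd_eq_listProd hl' fun p hp => ?_, PthetaProd_eq_listProd hl fun p hp => ?_]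
  · simp only [listProd, List.map_cons, List.prod_cons]
    rw [segPowM_colIdx (nonneg_of_mem_thetaStage hm _)]
    congr 2
    refine List.map_congr_left fun p hp => ?_
    rw [Finsupp.erase_ne ((hmem p).1 hp).1]
  · have hne : p ≠ colIdx N j := by rintro rfl; simp at hp
    rw [Finsupp.erase_ne hne] at hp
    exact (hmem p).2 ⟨hne, hp⟩
  · by_cases hne : p = colIdx N j
    · rw [hne]; exact List.mem_cons_self
    · exact List.mem_cons_of_mem _ ((hmem p).2 ⟨hne, hp⟩)

theorem PthetaProd_zero : PthetaProd 0 = 1 := PthetaProd_eq_listProd List.Pairwise.nil fun _ h => absurd rfl h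

theorem isStageFamily_gen : IsStageFamily gen phi fun m => PthetaProd m • phi where
  zero := by rw [PthetaProd_zero, one_smul]
  step _ hm := by rw [PthetaProd_step hm, mul_smul]

theorem isStageFamily_genEnd : IsStageFamily genEnd phi fun m => PthetaProd m • phi where
  zero := by rw [PthetaProd_zero, one_smul]
  step {N j m} _ hm := by
    rw [PthetaProd_step hm, mul_smul]
    exact congrArg (· (PthetaProd (m.erase (colIdx N j)) • phi))
      (map_colPow (Algebra.lsmul K K Vt) gen N j (m (colIdx N j)).toNat)

theorem IsTheta.mem_thetaStage {m : MS} (h : IsTheta m) {N : ℕ} (hN : bound m ≤ N) :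
    m ∈ thetaStage N 0 :=
  ⟨h, fun p hp => by
    have h1 := (le_max_right _ _).trans ((le_bound hp).trans hN)
    have h2 := (h p.1 p.2 hp).2.2.2.1
    push_cast
    omega⟩

theorem exists_thetaStage {s : Finset MS} (hs : ∀ m ∈ s, IsTheta m) :
    ∃ N, ∀ m ∈ s, m ∈ thetaStage N 0 :=
  ⟨s.sup bound, fun m hm => (hs m hm).mem_thetaStage (Finset.le_sup hm)⟩

theorem mem_UA_iff {u : U} : u ∈ UA ↔ ∃ N, u ∈ intSubring gen N := by
  constructor
  · intro hu
    induction hu using Subring.closure_induction with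
    | mem x hx =>
      rcases hx with ⟨c, hc, rfl⟩ | ⟨_, n, ⟨a, rfl⟩, rfl⟩
      · exact ⟨0, algebraMap_mem_intSubring 0 hc⟩
      · refine ⟨a.natAbs + 1, ?_⟩
        rw [fgen_eq_gen, qfact_eq_gfact]
        exact gdp_mem_intSubring (by omega) (by omega) n
    | zero => exact ⟨0, zero_mem _⟩
    | one => exact ⟨0, one_mem _⟩
    | add x y _ _ hx hy =>
      obtain ⟨N, hN⟩ := hx
      obtain ⟨M, hM⟩ := hy
      exact ⟨max N M, add_mem (intSubring_mono (le_max_left N M) hN) (intSubring_mono (le_max_right N M) hM)⟩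
    | neg x _ hx =>
      obtain ⟨N, hN⟩ := hx
      exact ⟨N, neg_mem hN⟩
    | mul x y _ _ hx hy =>
      obtain ⟨N, hN⟩ := hx
      obtain ⟨M, hM⟩ := hy
      exact ⟨max N M, mul_mem (intSubring_mono (le_max_left N M) hN) (intSubring_mono (le_max_right N M) hM)⟩
  · rintro ⟨N, hu⟩
    refine Subring.closure_mono ?_ hu
    rintro x (⟨c, hc, rfl⟩ | ⟨a, n, -, -, rfl⟩)
    · exact Or.inl ⟨c, hc, rfl⟩
    · exact Or.inr ⟨2 * a + 1, n, ⟨a, rfl⟩, by rw [fgen_eq_gen, qfact_eq_gfact]; rfl⟩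

theorem mem_VA_iff {v : Vt} : v ∈ VA ↔ ∃ N, v ∈ intModule gen phi (N + 1) := by
  constructor
  · rintro ⟨u, hu, rfl⟩
    obtain ⟨N, hN⟩ := mem_UA_iff.1 hu
    exact ⟨N, u, intSubring_mono N.le_succ hN, rfl⟩
  · rintro ⟨N, u, hu, rfl⟩
    exact ⟨u, mem_UA_iff.2 ⟨_, hu⟩, rfl⟩

theorem linearIndepOn_PthetaProd (N : ℕ) :
    LinearIndepOn K (fun m => PthetaProd m • phi) (thetaStage N 0) := by
  obtain ⟨E, T, hE, hv⟩ := exists_twistedDerivation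
  exact isStageFamily_genEnd.linearIndepOn hE serreFamily_genEnd hv phi_ne_zero N (Nat.zero_le _)

theorem sum_Ptheta {c : MS →₀ K} (hc : ∀ m ∈ c.support, IsTheta m) :
    (c.sum fun m a => a • (Ptheta m • phi)) = c.sum fun m a => a • (PthetaProd m • phi) :=
  Finsupp.sum_congr fun m hm => by rw [Ptheta, if_pos (hc m hm)]

/-- Lemma 5.1 of Enomoto–Kashiwara: `V_θ(0)_A = ⊕_{m ∈ M_θ} A·P_θ(m)φ̃`, i.e. every
element of `V_θ(0)_A` is an `A`-linear combination of the `P_θ(m)φ̃` and the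
`A`-coefficients of such a combination are unique. -/
theorem VA_direct_sum_of_PBW :
    (∀ v : Vt, v ∈ VA ↔ ∃ c : MS →₀ K, (∀ m ∈ c.support, IsTheta m) ∧
        (∀ m, c m ∈ Aring) ∧ v = c.sum fun m a => a • (Ptheta m • phi)) ∧
    (∀ c c' : MS →₀ K, (∀ m ∈ c.support, IsTheta m) → (∀ m ∈ c'.support, IsTheta m) →
      (∀ m, c m ∈ Aring) → (∀ m, c' m ∈ Aring) →
      (c.sum fun m a => a • (Ptheta m • phi)) = (c'.sum fun m a => a • (Ptheta m • phi)) →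
      c = c') := by
  refine ⟨fun v => ⟨fun hv => ?_, ?_⟩, fun c c' hc hc' _ _ h => ?_⟩
  · obtain ⟨N, hN⟩ := mem_VA_iff.1 hv
    obtain ⟨c, hc, hcA, rfl⟩ :=
      (isStageFamily_gen.mem_intModule_iff serreFamily_gen gen_smul_phi).1 hN
    exact ⟨c, fun m hm => (hc m hm).1, hcA, (sum_Ptheta fun m hm => (hc m hm).1).symm⟩
  · rintro ⟨c, hc, hcA, rfl⟩
    obtain ⟨N, hN⟩ := exists_thetaStage hc
    exact mem_VA_iff.2 ⟨N, (isStageFamily_gen.mem_intModule_iff serreFamily_gen gen_smul_phi).2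
      ⟨c, hN, hcA, sum_Ptheta hc⟩⟩
  · obtain ⟨N, hN⟩ := exists_thetaStage (s := c.support ∪ c'.support) fun m hm =>
      (Finset.mem_union.1 hm).elim (hc m) (hc' m)
    rw [sum_Ptheta hc, sum_Ptheta hc'] at h
    refine sub_eq_zero.1 (linearIndepOn_iff.1 (linearIndepOn_PthetaProd N) (c - c') ?_ ?_)
    · exact fun m hm => hN m (Finsupp.support_sub hm)
    · rw [map_sub, sub_eq_zero]
      exact h

end
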